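/- arXiv:2307.16826 — 9 statements merged into one kernel-verified Lean document; each statement's English description precedes it below -/
import Mathlib

section
/- Let X be a set and C a collection of subsets of X such that X ∈ C and C is closed under finite intersections. Then the following are equivalent: (a) C is Noetherian, i.e. C satisfies the descending chain condition (every decreasing chain C_0 ⊇ C_1 ⊇ ⋯ of members of C eventually stabilises); (b) for every ultrafilter U on X, the collection U ∩ C of members of C belonging to U has a minimal element with respect to inclusion; (c) every ultrafilter U on X contains a set Y (not necessarily in C) which is contained in every member of U ∩ C. -/
/-- A family of subsets satisfies the descending chain condition if every
decreasing chain of members eventually stabilises. -/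
def FamilyDCC {X : Type*} (C : Set (Set X)) : Prop :=
  ∀ f : ℕ → Set X, (∀ n, f n ∈ C) → (∀ n, f (n + 1) ⊆ f n) →
    ∃ n₀, ∀ n, n₀ ≤ n → f n = f n₀

/-- In a family with the descending chain condition, every nonempty subfamily has a minimal
member. -/
theorem FamilyDCC.exists_minimal {X : Type*} {C S : Set (Set X)} (hC : FamilyDCC C)
    (hSC : S ⊆ C) (hS : S.Nonempty) : ∃ D ∈ S, ∀ A ∈ S, A ⊆ D → A = D := by
  by_contra! h
  choose! g hgS hgsub hgne using h
  obtain ⟨D, hD⟩ := hS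
  have hmem : ∀ n, g^[n] D ∈ S := fun n => by
    induction n with
    | zero => exact hD
    | succ n ih => rw [Function.iterate_succ_apply']; exact hgS _ ih
  obtain ⟨n, hn⟩ := hC (fun n => g^[n] D) (fun n => hSC (hmem n)) fun n => by
    rw [Function.iterate_succ_apply']; exact hgsub _ (hmem n)
  have hstep := hn (n + 1) n.le_succ
  rw [Function.iterate_succ_apply'] at hstep
  exact hgne _ (hmem n) hstep

/-- A decreasing sequence of sets that never reaches its intersection lies in an ultrafilter which
does not contain that intersection. -/
theorem Antitone.exists_ultrafilter_notMem_iInter {X : Type*} {f : ℕ → Set X} (hf : Antitone f)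
    (hne : ∀ n, ¬ f n ⊆ ⋂ m, f m) :
    ∃ U : Ultrafilter X, (∀ n, f n ∈ U) ∧ ⋂ m, f m ∉ U := by
  have hanti : Antitone fun n => Filter.principal (f n \ ⋂ m, f m) := fun _ _ hab =>
    Filter.principal_mono.2 (Set.sdiff_subset_sdiff_left (hf hab))
  have : (⨅ n, Filter.principal (f n \ ⋂ m, f m)).NeBot :=
    Filter.iInf_neBot_of_directed' hanti.directed_ge fun n =>
      Filter.principal_neBot_iff.2 (Set.sdiff_nonempty.2 (hne n))
  let U := Ultrafilter.of (⨅ n, Filter.principal (f n \ ⋂ m, f m))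
  have hU : ∀ n, f n \ ⋂ m, f m ∈ U := fun n =>
    Ultrafilter.of_le _ (Filter.mem_iInf_of_mem n (Filter.mem_principal_self _))
  exact ⟨U, fun n => Filter.mem_of_superset (hU n) Set.sdiff_subset,
    Ultrafilter.compl_mem_iff_notMem.1 (Filter.mem_of_superset (hU 0) fun _ hx => hx.2)⟩

/-- For a collection `C` of subsets of `X` containing `X` and closed
under finite (binary) intersections, the following are equivalent:
(a) `C` satisfies the descending chain condition;
(b) for every ultrafilter `U` on `X`, the family `U ∩ C` has a minimal element
with respect to inclusion;
(c) every ultrafilter `U` on `X` contains a set `Y` which is contained in every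
member of `U ∩ C`. -/
theorem noetherian_family_tfae {X : Type*} (C : Set (Set X))
    (hX : Set.univ ∈ C) (hInter : ∀ A ∈ C, ∀ B ∈ C, A ∩ B ∈ C) :
    List.TFAE
      [FamilyDCC C,
       ∀ U : Ultrafilter X, ∃ D ∈ C, D ∈ U ∧
          ∀ A ∈ C, A ∈ U → A ⊆ D → A = D,
       ∀ U : Ultrafilter X, ∃ Y ∈ U, ∀ A ∈ C, A ∈ U → Y ⊆ A] := by
  tfae_have 1 → 2 := fun h U => by
    obtain ⟨D, ⟨hDC, hDU⟩, hD⟩ := h.exists_minimal (S := {A | A ∈ C ∧ A ∈ U})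
      (fun _ hA => hA.1) ⟨Set.univ, hX, Filter.univ_mem⟩
    exact ⟨D, hDC, hDU, fun A hAC hAU => hD A ⟨hAC, hAU⟩⟩
  tfae_have 2 → 3 := fun h U => by
    obtain ⟨D, hDC, hDU, hD⟩ := h U
    exact ⟨D, hDU, fun A hAC hAU => Set.inter_eq_right.1
      (hD _ (hInter A hAC D hDC) (Filter.inter_mem hAU hDU) Set.inter_subset_right)⟩
  tfae_have 3 → 1 := fun h f hfC hf => by
    have hanti : Antitone f := antitone_nat_of_succ_le hf
    by_contra! hstab
    obtain ⟨U, hfU, hU⟩ := hanti.exists_ultrafilter_notMem_iInter fun n hn => by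
      obtain ⟨m, hnm, hne⟩ := hstab n
      exact hne ((hanti hnm).antisymm (hn.trans (Set.iInter_subset f m)))
    obtain ⟨Y, hYU, hY⟩ := h U
    exact hU (Filter.mem_of_superset hYU
      (Set.subset_iInter fun n => hY _ (hfC n) (hfU n)))
  tfae_finish
end

section
/- Let C be a Noetherian collection of subsets of a set X and let A ∈ C be nonempty. If A = C_1 ∪ ⋯ ∪ C_n = D_1 ∪ ⋯ ∪ D_m are two irredundant decompositions of A into irreducible members of C (irredundant meaning no set of the decomposition is contained in another one of the same decomposition), then n = m and the lists (C_1,…,C_n) and (D_1,…,D_m) coincide up to a permutation. Hence the irreducible components of A are uniquely determined. -/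
/-- A collection of subsets of `X` is Noetherian if it contains `X`, is closed
under finite (binary) intersections and satisfies the descending chain condition. -/
def NoetherianFamily {X : Type*} (C : Set (Set X)) : Prop :=
  Set.univ ∈ C ∧ (∀ A ∈ C, ∀ B ∈ C, A ∩ B ∈ C) ∧ FamilyDCC C

/-- A member `A` of `C` is irreducible if it is nonempty and cannot be written as a
finite union of proper subsets belonging to `C`. -/
def IrredIn {X : Type*} (C : Set (Set X)) (A : Set X) : Prop :=
  A ∈ C ∧ A.Nonempty ∧
    ∀ S : Finset (Set X), ↑S ⊆ C → (∀ B ∈ S, B ⊂ A) → A ≠ ⋃₀ ↑S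

/-- An irreducible member of an intersection-closed family that is covered by finitely many
members of the family is contained in one of them. -/
theorem IrredIn.exists_subset_of_subset_sUnion {X : Type*} {C : Set (Set X)}
    (hC : ∀ A ∈ C, ∀ B ∈ C, A ∩ B ∈ C) {A : Set X} (hA : IrredIn C A)
    {S : Finset (Set X)} (hS : ∀ B ∈ S, B ∈ C) (hAS : A ⊆ ⋃₀ ↑S) : ∃ B ∈ S, A ⊆ B := by
  classical
  by_contra! hcon
  refine hA.2.2 (S.image (A ∩ ·)) ?_ ?_ ?_
  · simp only [Finset.coe_image, Set.image_subset_iff]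
    exact fun B hB => hC A hA.1 B (hS B hB)
  · simp only [Finset.mem_image]
    rintro _ ⟨B, hB, rfl⟩
    exact ⟨Set.inter_subset_left, fun h => hcon B hB fun x hx => (h hx).2⟩
  · rw [Finset.coe_image, Set.sUnion_image, ← Set.inter_iUnion₂, ← Set.sUnion_eq_biUnion]
    exact (Set.inter_eq_left.2 hAS).symm

/-- If two finite sets of irreducible members of an intersection-closed family have the same
union and the first is irredundant, then the first is contained in the second. -/
theorem subset_of_irredundant_of_sUnion_eq {X : Type*} {C : Set (Set X)}
    (hC : ∀ A ∈ C, ∀ B ∈ C, A ∩ B ∈ C) {S T : Finset (Set X)}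
    (hS : ∀ B ∈ S, IrredIn C B) (hirr : ∀ B ∈ S, ∀ B' ∈ S, B ≠ B' → ¬ B ⊆ B')
    (hT : ∀ B ∈ T, IrredIn C B) (hST : ⋃₀ (S : Set (Set X)) = ⋃₀ ↑T) : S ⊆ T := by
  intro B hB
  obtain ⟨D, hD, hBD⟩ := (hS B hB).exists_subset_of_subset_sUnion hC (fun D hD => (hT D hD).1)
    (hST ▸ Set.subset_sUnion_of_mem hB)
  obtain ⟨B', hB', hDB'⟩ := (hT D hD).exists_subset_of_subset_sUnion hC
    (fun B hB => (hS B hB).1) (hST ▸ Set.subset_sUnion_of_mem hD)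
  obtain rfl : B = B' := by_contra fun h => hirr B hB B' hB' h (hBD.trans hDB')
  rwa [hBD.antisymm hDB']

/-- In a Noetherian collection `C`, two irredundant decompositions of a
nonempty member `A` of `C` into irreducible members of `C` coincide up to permutation:
note that irredundancy (`Cᵢ ⊄ Cⱼ` for `i ≠ j`) forces the members of each decomposition
to be pairwise distinct, so a decomposition is faithfully recorded by a finite set, and
two irredundant decompositions have the same number of members and the same members. -/
theorem irredundant_decomposition_unique {X : Type*} (C : Set (Set X))
    (hC : NoetherianFamily C) (A : Set X) (hA : A ∈ C) (hne : A.Nonempty)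
    (S T : Finset (Set X))
    (hS₁ : ∀ B ∈ S, IrredIn C B)
    (hS₂ : ∀ B ∈ S, ∀ B' ∈ S, B ≠ B' → ¬ B ⊆ B')
    (hSA : A = ⋃₀ ↑S)
    (hT₁ : ∀ B ∈ T, IrredIn C B)
    (hT₂ : ∀ B ∈ T, ∀ B' ∈ T, B ≠ B' → ¬ B ⊆ B')
    (hTA : A = ⋃₀ ↑T) :
    S = T ∧ S.card = T.card := by
  have hST : ⋃₀ (S : Set (Set X)) = ⋃₀ ↑T := hSA.symm.trans hTA
  have h : S = T := (subset_of_irredundant_of_sUnion_eq hC.2.1 hS₁ hS₂ hT₁ hST).antisymm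
    (subset_of_irredundant_of_sUnion_eq hC.2.1 hT₁ hT₂ hS₁ hST.symm)
  exact ⟨h, congrArg Finset.card h⟩
end

section
/- Let C be a Noetherian collection of subsets of a set X. If Y_1 and Y_2 are disjoint constructible subsets of X with Rirr(Y_1) = Rirr(Y_2), then deg_C(Y_1 ∪ Y_2) = deg_C(Y_1) + deg_C(Y_2). -/
/-- The closed sets of the topology `T_C` are the finite unions of members of `C`. -/
def IsClosedIn {X : Type*} (C : Set (Set X)) (A : Set X) : Prop :=
  ∃ S : Finset (Set X), ↑S ⊆ C ∧ A = ⋃₀ ↑S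

/-- A set is `T_C`-open if its complement is `T_C`-closed. -/
def IsOpenIn {X : Type*} (C : Set (Set X)) (O : Set X) : Prop :=
  IsClosedIn C Oᶜ

/-- The `T_C`-closure of a subset: the intersection of all closed sets containing it. -/
def closureIn {X : Type*} (C : Set (Set X)) (Y : Set X) : Set X :=
  ⋂₀ {A | IsClosedIn C A ∧ Y ⊆ A}

/-- The foundational rank `Rirr` of an irreducible member of `C` with respect to strict
inclusion among irreducible members of `C` (the descending chain condition makes this
relation well-founded; outside of that situation the value is junk). -/
noncomputable def rirrOrd {X : Type*} (C : Set (Set X)) (A : Set X) : Ordinal :=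
  open Classical in
  if h : WellFounded (fun B B' : Set X => IrredIn C B ∧ IrredIn C B' ∧ B ⊂ B')
  then (h.apply A).rank else 0

open Classical in
/-- The rank `Rirr` of an arbitrary subset `Y` of `X`: the maximum of the ranks of the
irreducible members of `C` contained in the `T_C`-closure of `Y` (equivalently, of the
irreducible components of the closure), and `⊥` (i.e. `-∞`) if there are none, which
for a Noetherian collection happens exactly when `Y` is empty. -/
noncomputable def rirr {X : Type*} (C : Set (Set X)) (Y : Set X) : WithBot Ordinal :=
  if ∃ B, IrredIn C B ∧ B ⊆ closureIn C Y then
    ↑(sSup {o : Ordinal | ∃ B, IrredIn C B ∧ B ⊆ closureIn C Y ∧ o = rirrOrd C B})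
  else ⊥

/-- The degree of a subset `Y` of `X`: the number of irreducible members of `C`
contained in the `T_C`-closure of `Y` whose rank equals `Rirr(Y)`. -/
noncomputable def degC {X : Type*} (C : Set (Set X)) (Y : Set X) : ℕ :=
  Set.ncard {B | IrredIn C B ∧ B ⊆ closureIn C Y ∧ (rirrOrd C B : WithBot Ordinal) = rirr C Y}

/-- Constructible subsets: finite Boolean combinations of `T_C`-closed sets. -/
inductive ConstructibleIn {X : Type*} (C : Set (Set X)) : Set X → Prop
  | of_closed : ∀ A, IsClosedIn C A → ConstructibleIn C A
  | compl : ∀ A, ConstructibleIn C A → ConstructibleIn C Aᶜ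
  | union : ∀ A B, ConstructibleIn C A → ConstructibleIn C B → ConstructibleIn C (A ∪ B)

section NoetherianFamily

variable {X : Type*} {C : Set (Set X)}

theorem IsClosedIn.of_mem {A : Set X} (hA : A ∈ C) : IsClosedIn C A :=
  ⟨{A}, by simpa using hA, by simp⟩

theorem isClosedIn_empty : IsClosedIn C (∅ : Set X) :=
  ⟨∅, by simp, by simp⟩

theorem IsClosedIn.union {A B : Set X} (hA : IsClosedIn C A) (hB : IsClosedIn C B) :
    IsClosedIn C (A ∪ B) := by
  classical
  obtain ⟨S, hS, rfl⟩ := hA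
  obtain ⟨T, hT, rfl⟩ := hB
  exact ⟨S ∪ T, by simp [hS, hT], by simp [Set.sUnion_union]⟩

theorem isClosedIn_biUnion (S : Finset (Set X)) (f : Set X → Set X)
    (hf : ∀ A ∈ S, IsClosedIn C (f A)) : IsClosedIn C (⋃ A ∈ S, f A) := by
  classical
  induction S using Finset.induction_on with
  | empty => simpa using isClosedIn_empty
  | insert A S _ ih =>
    rw [Finset.set_biUnion_insert]
    exact (hf A (by simp)).union (ih fun B hB => hf B (by simp [hB]))

theorem NoetherianFamily.wellFounded (hC : NoetherianFamily C) :
    WellFounded fun A B : Set X => A ∈ C ∧ B ∈ C ∧ A ⊂ B := by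
  rw [wellFounded_iff_isEmpty_descending_chain]
  refine ⟨fun ⟨f, hf⟩ => ?_⟩
  obtain ⟨n, hn⟩ := hC.2.2 f (fun n => (hf n).2.1) fun n => (hf n).2.2.subset
  exact (hf n).2.2.ne (hn (n + 1) n.le_succ)

theorem NoetherianFamily.wellFounded_irredIn (hC : NoetherianFamily C) :
    WellFounded fun A B : Set X => IrredIn C A ∧ IrredIn C B ∧ A ⊂ B :=
  Subrelation.wf (fun h => ⟨h.1.1, h.2.1.1, h.2.2⟩) hC.wellFounded

theorem subset_closureIn (Y : Set X) : Y ⊆ closureIn C Y :=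
  Set.subset_sInter fun _ hA => hA.2

theorem closureIn_subset {Y A : Set X} (hA : IsClosedIn C A) (h : Y ⊆ A) :
    closureIn C Y ⊆ A :=
  Set.sInter_subset_of_mem ⟨hA, h⟩

theorem closureIn_mono {Y Z : Set X} (h : Y ⊆ Z) : closureIn C Y ⊆ closureIn C Z :=
  Set.sInter_subset_sInter fun _ hA => ⟨hA.1, h.trans hA.2⟩

theorem NoetherianFamily.isClosedIn_inter_sInter (hC : NoetherianFamily C)
    {𝒜 : Set (Set X)} (h𝒜 : ∀ A ∈ 𝒜, IsClosedIn C A) {A : Set X} (hA : A ∈ C) :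
    IsClosedIn C (A ∩ ⋂₀ 𝒜) := by
  induction A using hC.wellFounded.induction with
  | _ A ih =>
    by_cases h : A ⊆ ⋂₀ 𝒜
    · rw [Set.inter_eq_left.2 h]
      exact .of_mem hA
    · obtain ⟨F, hF, hAF⟩ : ∃ F ∈ 𝒜, ¬ A ⊆ F := by
        simpa only [Set.subset_sInter_iff, not_forall, exists_prop] using h
      obtain ⟨S, hS, rfl⟩ := h𝒜 F hF
      have key : A ∩ ⋂₀ 𝒜 = ⋃ B ∈ S, (A ∩ B) ∩ ⋂₀ 𝒜 := by
        ext x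
        simp only [Set.mem_inter_iff, Set.mem_iUnion, exists_prop]
        constructor
        · rintro ⟨hxA, hx⟩
          obtain ⟨B, hB, hxB⟩ := hx _ hF
          exact ⟨B, hB, ⟨hxA, hxB⟩, hx⟩
        · rintro ⟨B, hB, ⟨hxA, -⟩, hx⟩
          exact ⟨hxA, hx⟩
      rw [key]
      refine isClosedIn_biUnion S _ fun B hB => ?_
      have hAB : A ∩ B ∈ C := hC.2.1 A hA B (hS hB)
      refine ih (A ∩ B) ⟨hAB, hA, Set.inter_subset_left, fun h => hAF fun x hx => ?_⟩ hAB
      exact ⟨B, hB, (h hx).2⟩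

theorem NoetherianFamily.isClosedIn_closureIn (hC : NoetherianFamily C) (Y : Set X) :
    IsClosedIn C (closureIn C Y) := by
  simpa only [closureIn, Set.univ_inter] using
    hC.isClosedIn_inter_sInter (fun A (hA : A ∈ {A | IsClosedIn C A ∧ Y ⊆ A}) => hA.1) hC.1

theorem IrredIn.exists_subset (hC : NoetherianFamily C) {B : Set X} (hB : IrredIn C B)
    {S : Finset (Set X)} (hS : ↑S ⊆ C) (h : B ⊆ ⋃₀ ↑S) : ∃ A ∈ S, B ⊆ A := by
  classical
  by_contra! hn
  refine hB.2.2 (S.image fun A => B ∩ A) ?_ ?_ ?_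
  · intro D hD
    obtain ⟨A, hA, rfl⟩ := Finset.mem_image.1 (Finset.mem_coe.1 hD)
    exact hC.2.1 B hB.1 A (hS hA)
  · intro D hD
    obtain ⟨A, hA, rfl⟩ := Finset.mem_image.1 hD
    exact ⟨Set.inter_subset_left, fun h => hn A hA fun x hx => (h hx).2⟩
  · ext x
    constructor
    · intro hx
      obtain ⟨A, hA, hxA⟩ := h hx
      exact ⟨B ∩ A, by simpa using ⟨A, hA, rfl⟩, hx, hxA⟩
    · rintro ⟨D, hD, hxD⟩
      obtain ⟨A, hA, rfl⟩ := Finset.mem_image.1 (Finset.mem_coe.1 hD)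
      exact hxD.1

theorem IrredIn.subset_or_subset (hC : NoetherianFamily C) {B A₁ A₂ : Set X}
    (hB : IrredIn C B) (h₁ : IsClosedIn C A₁) (h₂ : IsClosedIn C A₂) (h : B ⊆ A₁ ∪ A₂) :
    B ⊆ A₁ ∨ B ⊆ A₂ := by
  classical
  obtain ⟨S, hS, rfl⟩ := h₁
  obtain ⟨T, hT, rfl⟩ := h₂
  obtain ⟨A, hA, hBA⟩ := hB.exists_subset hC (S := S ∪ T) (by simp [hS, hT])
    (by simpa [Set.sUnion_union] using h)
  rcases Finset.mem_union.1 hA with hA | hA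
  · exact .inl (hBA.trans (Set.subset_sUnion_of_mem hA))
  · exact .inr (hBA.trans (Set.subset_sUnion_of_mem hA))

theorem IrredIn.subset_closureIn_union (hC : NoetherianFamily C) {B Y₁ Y₂ : Set X}
    (hB : IrredIn C B) :
    B ⊆ closureIn C (Y₁ ∪ Y₂) ↔ B ⊆ closureIn C Y₁ ∨ B ⊆ closureIn C Y₂ := by
  constructor
  · intro h
    have h₁ := hC.isClosedIn_closureIn Y₁
    have h₂ := hC.isClosedIn_closureIn Y₂
    exact hB.subset_or_subset hC h₁ h₂ (h.trans (closureIn_subset (h₁.union h₂)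
      (Set.union_subset_union (subset_closureIn _) (subset_closureIn _))))
  · rintro (h | h)
    · exact h.trans (closureIn_mono Set.subset_union_left)
    · exact h.trans (closureIn_mono Set.subset_union_right)

theorem exists_finset_irredIn_biUnion (S : Finset (Set X)) (f : Set X → Set X)
    (hf : ∀ A ∈ S, ∃ T : Finset (Set X), (∀ B ∈ T, IrredIn C B) ∧ f A = ⋃₀ ↑T) :
    ∃ T : Finset (Set X), (∀ B ∈ T, IrredIn C B) ∧ (⋃ A ∈ S, f A) = ⋃₀ ↑T := by
  classical
  choose! T hT hfT using hf
  refine ⟨S.biUnion T, ?_, ?_⟩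
  · intro B hB
    obtain ⟨A, hA, hBA⟩ := Finset.mem_biUnion.1 hB
    exact hT A hA B hBA
  · ext x
    simp only [Set.mem_iUnion, exists_prop, Set.mem_sUnion, Finset.mem_coe, Finset.mem_biUnion]
    constructor
    · rintro ⟨A, hA, hx⟩
      rw [hfT A hA] at hx
      obtain ⟨B, hB, hxB⟩ := hx
      exact ⟨B, ⟨A, hA, hB⟩, hxB⟩
    · rintro ⟨B, ⟨A, hA, hB⟩, hxB⟩
      exact ⟨A, hA, by rw [hfT A hA]; exact ⟨B, hB, hxB⟩⟩

theorem NoetherianFamily.exists_irredIn_of_mem (hC : NoetherianFamily C) {A : Set X}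
    (hA : A ∈ C) : ∃ T : Finset (Set X), (∀ B ∈ T, IrredIn C B) ∧ A = ⋃₀ ↑T := by
  induction A using hC.wellFounded.induction with
  | _ A ih =>
    by_cases hirr : IrredIn C A
    · exact ⟨{A}, by simpa using hirr, by simp⟩
    rcases A.eq_empty_or_nonempty with rfl | hne
    · exact ⟨∅, by simp, by simp⟩
    obtain ⟨S, hS, hlt, hAS⟩ : ∃ S : Finset (Set X), ↑S ⊆ C ∧ (∀ B ∈ S, B ⊂ A) ∧ A = ⋃₀ ↑S := by
      by_contra! hn
      exact hirr ⟨hA, hne, hn⟩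
    have := exists_finset_irredIn_biUnion S id fun B hB => ih B ⟨hS hB, hA, hlt B hB⟩ (hS hB)
    rwa [show (⋃ B ∈ S, id B) = A by simp [hAS, Set.sUnion_eq_biUnion]] at this

theorem NoetherianFamily.exists_irredIn_of_isClosedIn (hC : NoetherianFamily C) {A : Set X}
    (hA : IsClosedIn C A) : ∃ T : Finset (Set X), (∀ B ∈ T, IrredIn C B) ∧ A = ⋃₀ ↑T := by
  obtain ⟨S, hS, rfl⟩ := hA
  have := exists_finset_irredIn_biUnion S id fun B hB => hC.exists_irredIn_of_mem (hS hB)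
  rwa [show (⋃ B ∈ S, id B) = ⋃₀ ↑S by simp [Set.sUnion_eq_biUnion]] at this

theorem rirrOrd_lt_of_ssubset (hC : NoetherianFamily C) {A B : Set X} (hA : IrredIn C A)
    (hB : IrredIn C B) (h : A ⊂ B) : rirrOrd C A < rirrOrd C B := by
  rw [rirrOrd, rirrOrd, dif_pos hC.wellFounded_irredIn, dif_pos hC.wellFounded_irredIn]
  exact Acc.rank_lt_of_rel _ ⟨hA, hB, h⟩

theorem bddAbove_rirrOrd (Z : Set X) :
    BddAbove {o : Ordinal | ∃ B, IrredIn C B ∧ B ⊆ Z ∧ o = rirrOrd C B} := by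
  refine (Ordinal.bddAbove_of_small (s := Set.range (rirrOrd C))).mono ?_
  rintro o ⟨B, -, -, rfl⟩
  exact ⟨B, rfl⟩

theorem rirrOrd_le_rirr {B Y : Set X} (hB : IrredIn C B) (h : B ⊆ closureIn C Y) :
    (rirrOrd C B : WithBot Ordinal) ≤ rirr C Y := by
  rw [rirr, if_pos ⟨B, hB, h⟩, WithBot.coe_le_coe]
  exact le_csSup (bddAbove_rirrOrd _) ⟨B, hB, h, rfl⟩

theorem rirr_le_iff {Y : Set X} {r : WithBot Ordinal} :
    rirr C Y ≤ r ↔ ∀ B, IrredIn C B → B ⊆ closureIn C Y → (rirrOrd C B : WithBot Ordinal) ≤ r := by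
  refine ⟨fun h B hB hBY => (rirrOrd_le_rirr hB hBY).trans h, fun h => ?_⟩
  by_cases hex : ∃ B, IrredIn C B ∧ B ⊆ closureIn C Y
  · obtain ⟨B, hB, hBY⟩ := hex
    have hr := h B hB hBY
    induction r with
    | bot => simp at hr
    | coe r =>
      rw [rirr, if_pos ⟨B, hB, hBY⟩, WithBot.coe_le_coe]
      refine csSup_le ⟨_, B, hB, hBY, rfl⟩ ?_
      rintro o ⟨D, hD, hDY, rfl⟩
      exact WithBot.coe_le_coe.1 (h D hD hDY)
  · rw [rirr, if_neg hex]
    exact bot_le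

theorem rirr_union (hC : NoetherianFamily C) (Y₁ Y₂ : Set X) :
    rirr C (Y₁ ∪ Y₂) = max (rirr C Y₁) (rirr C Y₂) := by
  refine eq_of_forall_ge_iff fun r => ?_
  simp only [max_le_iff, rirr_le_iff]
  constructor
  · exact fun h => ⟨fun B hB hBY => h B hB ((hB.subset_closureIn_union hC).2 (.inl hBY)),
      fun B hB hBY => h B hB ((hB.subset_closureIn_union hC).2 (.inr hBY))⟩
  · rintro ⟨h₁, h₂⟩ B hB hBY
    exact ((hB.subset_closureIn_union hC).1 hBY).elim (h₁ B hB) (h₂ B hB)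

theorem eq_of_rirrOrd_eq_rirr (hC : NoetherianFamily C) {A B Y : Set X} (hB : IrredIn C B)
    (hr : (rirrOrd C B : WithBot Ordinal) = rirr C Y) (hA : IrredIn C A)
    (hAY : A ⊆ closureIn C Y) (h : B ⊆ A) : B = A := by
  by_contra hne
  have hlt := rirrOrd_lt_of_ssubset hC hB hA (h.ssubset_of_ne hne)
  have hle := rirrOrd_le_rirr hA hAY
  rw [← hr, WithBot.coe_le_coe] at hle
  exact hle.not_gt hlt

theorem finite_rirrOrd_eq_rirr (hC : NoetherianFamily C) (Y : Set X) :
    {B | IrredIn C B ∧ B ⊆ closureIn C Y ∧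
      (rirrOrd C B : WithBot Ordinal) = rirr C Y}.Finite := by
  obtain ⟨T, hT, hYT⟩ := hC.exists_irredIn_of_isClosedIn (hC.isClosedIn_closureIn Y)
  refine T.finite_toSet.subset ?_
  rintro B ⟨hB, hBY, hr⟩
  obtain ⟨A, hA, hBA⟩ := hB.exists_subset hC (fun D hD => (hT D hD).1) (hYT ▸ hBY)
  have hAY : A ⊆ closureIn C Y := hYT ▸ Set.subset_sUnion_of_mem hA
  rwa [eq_of_rirrOrd_eq_rirr hC hB hr (hT A hA) hAY hBA]

theorem ConstructibleIn.exists_diff_subset (hC : NoetherianFamily C) {B Y : Set X}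
    (hB : IrredIn C B) (hY : ConstructibleIn C Y) :
    ∃ F, IsClosedIn C F ∧ ¬ B ⊆ F ∧ (B \ F ⊆ Y ∨ B \ F ⊆ Yᶜ) := by
  induction hY with
  | of_closed A hA =>
    by_cases h : B ⊆ A
    · exact ⟨∅, isClosedIn_empty, fun h => hB.2.1.ne_empty (Set.subset_empty_iff.1 h),
        .inl (Set.sdiff_subset.trans h)⟩
    · exact ⟨A, hA, h, .inr fun x hx => hx.2⟩
  | compl A _ ih =>
    obtain ⟨F, hF, hBF, h⟩ := ih
    exact ⟨F, hF, hBF, by rw [compl_compl]; exact h.symm⟩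
  | union A D _ _ ihA ihD =>
    obtain ⟨F, hF, hBF, h⟩ := ihA
    obtain ⟨G, hG, hBG, h'⟩ := ihD
    refine ⟨F ∪ G, hF.union hG,
      fun h => (hB.subset_or_subset hC hF hG h).elim hBF hBG, ?_⟩
    have hF' : B \ (F ∪ G) ⊆ B \ F := Set.sdiff_subset_sdiff_right Set.subset_union_left
    have hG' : B \ (F ∪ G) ⊆ B \ G := Set.sdiff_subset_sdiff_right Set.subset_union_right
    rcases h with h | h
    · exact .inl ((hF'.trans h).trans Set.subset_union_left)
    rcases h' with h' | h'
    · exact .inl ((hG'.trans h').trans Set.subset_union_right)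
    · rw [Set.compl_union]
      exact .inr (Set.subset_inter (hF'.trans h) (hG'.trans h'))

theorem ConstructibleIn.exists_diff_subset_of_rirrOrd_eq_rirr (hC : NoetherianFamily C)
    {B Y : Set X} (hY : ConstructibleIn C Y) (hB : IrredIn C B) (hBY : B ⊆ closureIn C Y)
    (hr : (rirrOrd C B : WithBot Ordinal) = rirr C Y) :
    ∃ F, IsClosedIn C F ∧ ¬ B ⊆ F ∧ B \ F ⊆ Y := by
  classical
  obtain ⟨F, hF, hBF, h | h⟩ := hY.exists_diff_subset hC hB
  · exact ⟨F, hF, hBF, h⟩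
  exfalso
  obtain ⟨T, hT, hYT⟩ := hC.exists_irredIn_of_isClosedIn (hC.isClosedIn_closureIn Y)
  have hE : ↑(T.erase B) ⊆ C := fun D hD => (hT D (Finset.mem_of_mem_erase hD)).1
  have hcl : IsClosedIn C (⋃₀ ↑(T.erase B)) := ⟨_, hE, rfl⟩
  have hsub : Y ⊆ ⋃₀ ↑(T.erase B) ∪ F := by
    intro x hx
    by_cases hxF : x ∈ F
    · exact .inr hxF
    obtain ⟨A, hA, hxA⟩ := hYT ▸ subset_closureIn Y hx
    refine .inl ⟨A, Finset.mem_erase.2 ⟨?_, hA⟩, hxA⟩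
    rintro rfl
    exact h ⟨hxA, hxF⟩ hx
  rcases hB.subset_or_subset hC hcl hF (hBY.trans (closureIn_subset (hcl.union hF) hsub))
    with h' | h'
  · obtain ⟨A, hA, hBA⟩ := hB.exists_subset hC hE h'
    obtain ⟨hne, hAT⟩ := Finset.mem_erase.1 hA
    have hAY : A ⊆ closureIn C Y := hYT ▸ Set.subset_sUnion_of_mem hAT
    exact hne (eq_of_rirrOrd_eq_rirr hC hB hr (hT A hAT) hAY hBA).symm
  · exact hBF h'

end NoetherianFamily

/-- Let `C` be a Noetherian collection of subsets of `X`. If `Y₁` and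
`Y₂` are disjoint constructible subsets of `X` with `Rirr(Y₁) = Rirr(Y₂)`, then
`deg_C(Y₁ ∪ Y₂) = deg_C(Y₁) + deg_C(Y₂)`. -/
theorem degC_union_of_disjoint {X : Type*} (C : Set (Set X))
    (hC : NoetherianFamily C) (Y₁ Y₂ : Set X)
    (h₁ : ConstructibleIn C Y₁) (h₂ : ConstructibleIn C Y₂)
    (hdisj : Disjoint Y₁ Y₂) (hrank : rirr C Y₁ = rirr C Y₂) :
    degC C (Y₁ ∪ Y₂) = degC C Y₁ + degC C Y₂ := by
  have hr : rirr C (Y₁ ∪ Y₂) = rirr C Y₁ := by rw [rirr_union hC, ← hrank, max_self]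
  rw [degC, degC, degC, ← Set.ncard_union_eq ?_ (finite_rirrOrd_eq_rirr hC Y₁)
    (finite_rirrOrd_eq_rirr hC Y₂)]
  · congr 1
    ext B
    simp only [Set.mem_union, Set.mem_ofPred_eq, hr, ← hrank]
    constructor
    · rintro ⟨hB, hBY, hBr⟩
      exact ((hB.subset_closureIn_union hC).1 hBY).imp (⟨hB, ·, hBr⟩) (⟨hB, ·, hBr⟩)
    · rintro (⟨hB, hBY, hBr⟩ | ⟨hB, hBY, hBr⟩)
      · exact ⟨hB, (hB.subset_closureIn_union hC).2 (.inl hBY), hBr⟩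
      · exact ⟨hB, (hB.subset_closureIn_union hC).2 (.inr hBY), hBr⟩
  · rw [Set.disjoint_left]
    rintro B ⟨hB, hB₁, hr₁⟩ ⟨-, hB₂, hr₂⟩
    obtain ⟨F, hF, hBF, hFY⟩ := h₁.exists_diff_subset_of_rirrOrd_eq_rirr hC hB hB₁ hr₁
    obtain ⟨G, hG, hBG, hGY⟩ := h₂.exists_diff_subset_of_rirrOrd_eq_rirr hC hB hB₂ hr₂
    refine (hB.subset_or_subset hC hF hG fun x hx => ?_).elim hBF hBG
    by_contra hn
    rw [Set.mem_union, not_or] at hn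
    exact Set.disjoint_left.1 hdisj (hFY ⟨hx, hn.1⟩) (hGY ⟨hx, hn.2⟩)
end

section
/- Let C be a Noetherian collection of subsets of a set X and B the Boolean algebra of subsets of X generated by C. For an ultrafilter U on X, let D_U denote the minimal element of U ∩ C with respect to inclusion (which exists and is unique by Noetherianity). Then: (i) D_U is an irreducible member of C for every ultrafilter U on X; (ii) for every irreducible member D of C there exists an ultrafilter U on X with D_U = D; (iii) for any two ultrafilters U, V on X, if D_U = D_V then U and V contain exactly the same members of B. Hence the traces on B of ultrafilters on X are in bijection with the irreducible members of C. -/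
/-- The Boolean algebra of subsets of `X` generated by `C`: all finite Boolean
combinations of members of `C`. -/
inductive BoolGen {X : Type*} (C : Set (Set X)) : Set X → Prop
  | of_mem : ∀ A ∈ C, BoolGen C A
  | compl : ∀ A, BoolGen C A → BoolGen C Aᶜ
  | union : ∀ A B, BoolGen C A → BoolGen C B → BoolGen C (A ∪ B)

/-- `D` is the minimal element of `U ∩ C` with respect to inclusion: a member of `C`
belonging to the ultrafilter `U` such that no member of `C` belonging to `U` is
properly contained in it. -/
def MinClosedOf {X : Type*} (C : Set (Set X)) (U : Ultrafilter X) (D : Set X) : Prop :=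
  D ∈ C ∧ D ∈ U ∧ ∀ A ∈ C, A ∈ U → A ⊆ D → A = D

theorem MinClosedOf.mem_iff_subset {X : Type*} {C : Set (Set X)} {U : Ultrafilter X}
    {D A : Set X} (hinter : ∀ A ∈ C, ∀ B ∈ C, A ∩ B ∈ C) (hD : MinClosedOf C U D)
    (hA : A ∈ C) : A ∈ U ↔ D ⊆ A := by
  obtain ⟨hDC, hDU, hmin⟩ := hD
  refine ⟨fun hAU => ?_, Filter.mem_of_superset hDU⟩
  exact Set.inter_eq_right.1
    (hmin _ (hinter A hA D hDC) (Filter.inter_mem hAU hDU) Set.inter_subset_right)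

theorem MinClosedOf.irredIn {X : Type*} {C : Set (Set X)} {U : Ultrafilter X} {D : Set X}
    (hD : MinClosedOf C U D) : IrredIn C D := by
  obtain ⟨hDC, hDU, hmin⟩ := hD
  refine ⟨hDC, Ultrafilter.nonempty_of_mem hDU, fun S hSC hSD hunion => ?_⟩
  obtain ⟨B, hBS, hBU⟩ :=
    (Ultrafilter.finite_sUnion_mem_iff S.finite_toSet).1 (hunion ▸ hDU)
  exact (hSD B hBS).ne (hmin B (hSC hBS) hBU (hSD B hBS).subset)

/-- The filter of sets containing `D` up to a finite union of members of `C` properly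
contained in `D`. -/
def genericFilter {X : Type*} (C : Set (Set X)) (D : Set X) : Filter X :=
  Filter.comk
    (fun t => ∃ S : Finset (Set X), ↑S ⊆ C ∧ (∀ B ∈ S, B ⊂ D) ∧ t ∩ D ⊆ ⋃₀ ↑S)
    ⟨∅, by simp⟩
    (fun _ ⟨S, hSC, hSD, ht⟩ _ hst =>
      ⟨S, hSC, hSD, (Set.inter_subset_inter_left D hst).trans ht⟩)
    (fun s ⟨S, hSC, hSD, hs⟩ t ⟨T, hTC, hTD, ht⟩ => by
      classical
      refine ⟨S ∪ T, ?_, ?_, ?_⟩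
      · rw [Finset.coe_union]
        exact Set.union_subset hSC hTC
      · intro B hB
        exact (Finset.mem_union.1 hB).elim (hSD B) (hTD B)
      · rw [Finset.coe_union, Set.sUnion_union, Set.union_inter_distrib_right]
        exact Set.union_subset_union hs ht)

theorem mem_genericFilter {X : Type*} {C : Set (Set X)} {D s : Set X} :
    s ∈ genericFilter C D ↔
      ∃ S : Finset (Set X), ↑S ⊆ C ∧ (∀ B ∈ S, B ⊂ D) ∧ sᶜ ∩ D ⊆ ⋃₀ ↑S :=
  Iff.rfl

theorem IrredIn.genericFilter_neBot {X : Type*} {C : Set (Set X)} {D : Set X}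
    (hD : IrredIn C D) : (genericFilter C D).NeBot := by
  rw [Filter.neBot_iff, ne_eq, ← Filter.empty_mem_iff_bot, mem_genericFilter]
  rintro ⟨S, hSC, hSD, hS⟩
  rw [Set.compl_empty, Set.univ_inter] at hS
  exact hD.2.2 S hSC hSD (hS.antisymm (Set.sUnion_subset fun B hB => (hSD B hB).subset))

theorem IrredIn.exists_minClosedOf {X : Type*} {C : Set (Set X)} {D : Set X}
    (hD : IrredIn C D) : ∃ U : Ultrafilter X, MinClosedOf C U D := by
  have := hD.genericFilter_neBot
  obtain ⟨U, hU⟩ := Ultrafilter.exists_le (genericFilter C D)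
  refine ⟨U, hD.1, hU (mem_genericFilter.2 ⟨∅, by simp⟩), fun A hAC hAU hAD => ?_⟩
  by_contra hne
  have hA : Aᶜ ∈ genericFilter C D :=
    mem_genericFilter.2 ⟨{A}, by simpa using hAC, by simpa using hAD.ssubset_of_ne hne, by simp⟩
  exact Ultrafilter.compl_mem_iff_notMem.1 (hU hA) hAU

theorem BoolGen.mem_ultrafilter_iff {X : Type*} {C : Set (Set X)} {U V : Ultrafilter X}
    (h : ∀ A ∈ C, A ∈ U ↔ A ∈ V) {A : Set X} (hA : BoolGen C A) : A ∈ U ↔ A ∈ V := by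
  induction hA with
  | of_mem A hA => exact h A hA
  | compl A _ ih => simp only [Ultrafilter.compl_mem_iff_notMem, ih]
  | union A B _ _ ihA ihB => simp only [Ultrafilter.union_mem_iff, ihA, ihB]

/-- For a Noetherian collection `C` of subsets of `X`:
(i) the minimal element `D_U` of any ultrafilter `U` is an irreducible member of `C`;
(ii) every irreducible member of `C` is the minimal element of some ultrafilter;
(iii) two ultrafilters with the same minimal element contain exactly the same members
of the Boolean algebra generated by `C`. Hence the traces on that Boolean algebra of
ultrafilters on `X` are in bijection with the irreducible members of `C`. -/
theorem minClosed_irreducible_correspondence {X : Type*} (C : Set (Set X))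
    (hC : NoetherianFamily C) :
    (∀ (U : Ultrafilter X) (D : Set X), MinClosedOf C U D → IrredIn C D) ∧
    (∀ D : Set X, IrredIn C D → ∃ U : Ultrafilter X, MinClosedOf C U D) ∧
    (∀ (U V : Ultrafilter X) (D : Set X), MinClosedOf C U D → MinClosedOf C V D →
      ∀ A : Set X, BoolGen C A → (A ∈ U ↔ A ∈ V)) := by
  refine ⟨fun U D hD => hD.irredIn, fun D hD => hD.exists_minClosedOf, ?_⟩
  intro U V D hU hV A hA
  exact hA.mem_ultrafilter_iff fun B hB =>
    (hU.mem_iff_subset hC.2.1 hB).trans (hV.mem_iff_subset hC.2.1 hB).symm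
end

section
/- Let E ⊊ K be a proper pair of algebraically closed fields and n ≥ 1. Then the collection of all tame subsets of K^n satisfies the descending chain condition: every decreasing chain S_0 ⊇ S_1 ⊇ ⋯ of tame subsets of K^n eventually stabilises. (Together with the known fact that every definable set in the pair (K, E) is a Boolean combination of tame sets, this shows that the theory of proper pairs of algebraically closed fields is Noetherian with respect to the family of tame formulae.) -/
open MvPolynomial

/-- A polynomial in the variables `X` (indexed by `Fin n`) and `Z` (indexed by `Fin r`)
is homogeneous in the variables `Z` if it is weighted homogeneous for the weight giving
`0` to each `X`-variable and `1` to each `Z`-variable. -/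
def HomogeneousInZ {K : Type*} [Field K] {n r : ℕ}
    (q : MvPolynomial (Fin n ⊕ Fin r) K) : Prop :=
  ∃ d, q.IsWeightedHomogeneous (Sum.elim (fun _ => (0 : ℕ)) (fun _ => 1)) d

/-- A subset `S` of `K^n` is tame (with respect to the subfield `E`) if it is the set of
points `x` such that some nonzero tuple `ζ` from `E` satisfies a fixed finite system of
polynomial equations `q j (x, ζ) = 0`, where each `q j` is homogeneous in the variables
of `ζ`. -/
def IsTameSet {K : Type*} [Field K] (E : Subfield K) {n : ℕ}
    (S : Set (Fin n → K)) : Prop :=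
  ∃ (r m : ℕ), 0 < r ∧ 0 < m ∧
    ∃ q : Fin m → MvPolynomial (Fin n ⊕ Fin r) K,
      (∀ j, HomogeneousInZ (q j)) ∧
      S = {x | ∃ ζ : Fin r → K, (∀ i, ζ i ∈ E) ∧ ζ ≠ 0 ∧
            ∀ j, MvPolynomial.eval (Sum.elim x ζ) (q j) = 0}

section Auxiliary

open scoped TensorProduct
open Filter

section Vanishing

variable {σ A L K I : Type*} [CommRing A] [CommRing L] [Field K]

/-- If the degree of every polynomial vanishing at `x` dominates that of some `f i`, and all the
`f i` vanish at `y` with leading coefficients not specializing to zero, then every polynomial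
vanishing at `x` vanishes at `y`. -/
theorem eval₂_eq_zero_of_degree_dominated (m : MonomialOrder σ) (α : A →+* L) (β : A →+* K)
    (x : σ → L) (y : σ → K) (f : I → MvPolynomial σ A)
    (hfx : ∀ i, eval₂ α x (f i) = 0) (hfy : ∀ i, eval₂ β y (f i) = 0)
    (hlead : ∀ i, β (m.leadingCoeff (f i)) ≠ 0)
    (hdeg : ∀ p : MvPolynomial σ A, p ≠ 0 → eval₂ α x p = 0 → ∃ i, m.degree (f i) ≤ m.degree p)
    (p : MvPolynomial σ A) (hp : eval₂ α x p = 0) : eval₂ β y p = 0 := by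
  induction hd : m.toSyn (m.degree p) using WellFoundedLT.induction generalizing p with
  | ind d ih =>
    subst hd
    by_cases hp0 : p = 0
    · simp [hp0]
    obtain ⟨i, hi⟩ := hdeg p hp0 hp
    have hs : eval₂ α x (m.sPolynomial p (f i)) = 0 := by
      simp [MonomialOrder.sPolynomial, eval₂_sub, eval₂_mul, hp, hfx]
    have key : eval₂ β y (m.sPolynomial p (f i)) = 0 := by
      rcases m.degree_sPolynomial p (f i) with h | h
      · rw [sup_eq_left.2 hi] at h
        exact ih _ h _ hs rfl
      · simp [h]
    rw [MonomialOrder.sPolynomial, tsub_eq_zero_of_le hi] at key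
    simpa [eval₂_sub, eval₂_mul, hfy, hlead] using key

end Vanishing

theorem eval₂_sumElim_mul_of_isWeightedHomogeneous {σ τ K L : Type*} [Finite σ] [Finite τ]
    [CommSemiring K] [CommSemiring L]
    (g : K →+* L) {q : MvPolynomial (σ ⊕ τ) K} {d : ℕ}
    (hq : q.IsWeightedHomogeneous (Sum.elim (fun _ => (0 : ℕ)) (fun _ => 1)) d)
    (x : σ → L) (z : τ → L) (c : L) :
    eval₂ g (Sum.elim x fun i => c * z i) q = c ^ d * eval₂ g (Sum.elim x z) q := by
  have := Fintype.ofFinite σ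
  have := Fintype.ofFinite τ
  rw [eval₂_eq', eval₂_eq', Finset.mul_sum]
  refine Finset.sum_congr rfl fun e he => ?_
  have hd := hq (mem_support_iff.1 he)
  rw [Finsupp.weight_apply, Finsupp.sum_fintype _ _ (by simp)] at hd
  simp only [Fintype.sum_sum_type, Sum.elim_inl, Sum.elim_inr, smul_eq_mul, mul_one, mul_zero,
    Finset.sum_const_zero, zero_add] at hd
  simp only [Fintype.prod_sum_type, Sum.elim_inl, Sum.elim_inr, mul_pow, Finset.prod_mul_distrib,
    Finset.prod_pow_eq_pow_sum, hd]
  ring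

theorem exists_algHom_eq_zero_of_mem_maximal {k B : Type*} [Field k] [IsAlgClosed k] [CommRing B]
    [Algebra k B] [Algebra.FiniteType k B] (N : Ideal B) [N.IsMaximal] :
    ∃ ψ : B →ₐ[k] k, ∀ b ∈ N, ψ b = 0 := by
  let := Ideal.Quotient.field N
  have : Module.Finite k (B ⧸ N) := finite_of_finite_type_of_isJacobsonRing _ _
  have hbij : Function.Bijective (algebraMap k (B ⧸ N)) :=
    IsAlgClosed.algebraMap_bijective_of_isIntegral
  let e := AlgEquiv.ofBijective (Algebra.ofId k (B ⧸ N)) hbij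
  refine ⟨(e.symm : (B ⧸ N) →ₐ[k] k).comp (Ideal.Quotient.mkₐ k N), fun b hb => ?_⟩
  simp [Ideal.Quotient.eq_zero_iff_mem.2 hb]

/-- A `k`-point of `A` extends to a larger algebra over which a given projective point is defined
and specializes. -/
theorem exists_algHom_extension_ne_zero {k F τ : Type*} [Field k] [IsAlgClosed k] [Field F]
    [Algebra k F] [Finite τ] (A : Subalgebra k F) (hA : A.FG) (φ : A →ₐ[k] k)
    (z : τ → F) (hz : z ≠ 0) :
    ∃ (B : Subalgebra k F) (hAB : A ≤ B) (_ : B.FG) (ψ : B →ₐ[k] k) (w : τ → B) (c : F),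
      (∀ a, ψ (Subalgebra.inclusion hAB a) = φ a) ∧ (∀ i, (w i : F) = c * z i) ∧
      ∃ i, ψ (w i) ≠ 0 := by
  have hne : RingHom.ker φ ≠ ⊤ := RingHom.ker_ne_top _
  obtain ⟨V, hAV, hV⟩ :=
    Ideal.image_subset_nonunits_valuationSubring (A := A.toSubring) (RingHom.ker φ) hne
  obtain ⟨i₁, hi₁⟩ := Function.ne_iff.1 hz
  have : Nonempty τ := ⟨i₁⟩
  obtain ⟨i₀, hi₀⟩ := Finite.exists_max fun i => V.valuation (z i)
  have hzi₀ : z i₀ ≠ 0 := by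
    intro h
    have := hi₀ i₁
    rw [h, map_zero, le_zero_iff, map_eq_zero] at this
    exact hi₁ this
  let B : Subalgebra k F := A ⊔ Algebra.adjoin k (Set.range fun i => (z i₀)⁻¹ * z i)
  have hAB : A ≤ B := le_sup_left
  have hwB (i) : (z i₀)⁻¹ * z i ∈ B :=
    (le_sup_right : _ ≤ B) (Algebra.subset_adjoin ⟨i, rfl⟩)
  have hBfg : B.FG := hA.sup (Subalgebra.fg_def.2 ⟨_, Set.finite_range _, rfl⟩)
  let V' : Subalgebra k F :=
    { V.toSubring with algebraMap_mem' := fun r => hAV (A.algebraMap_mem r) }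
  have hBV : B ≤ V' := by
    refine sup_le hAV (Algebra.adjoin_le ?_)
    rintro _ ⟨i, rfl⟩
    change _ ∈ V
    rw [← V.valuation_le_one_iff, map_mul, map_inv₀, inv_mul_le_iff₀, mul_one]
    · exact hi₀ i
    · simpa [zero_lt_iff] using hzi₀
  let j : B →+* V := Subring.inclusion (S := B.toSubring) (T := V.toSubring) hBV
  have hp : (IsLocalRing.maximalIdeal V).comap j ≠ ⊤ :=
    Ideal.comap_ne_top _ (IsLocalRing.maximalIdeal.isMaximal V).ne_top
  obtain ⟨N, hN, hle⟩ := Ideal.exists_le_maximal _ hp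
  have : Algebra.FiniteType k B := B.fg_iff_finiteType.1 hBfg
  obtain ⟨ψ, hψ⟩ := exists_algHom_eq_zero_of_mem_maximal (k := k) N
  refine ⟨B, hAB, hBfg, ψ, fun i => ⟨_, hwB i⟩, (z i₀)⁻¹, fun a => ?_, fun i => rfl, i₀, ?_⟩
  · have ha : (a - algebraMap k A (φ a) : A) ∈ RingHom.ker φ := by simp [RingHom.mem_ker]
    have h1 := hV ⟨_, ha, rfl⟩
    have h2 : Subalgebra.inclusion hAB (a - algebraMap k A (φ a)) ∈ N := by
      apply hle
      rw [Ideal.mem_comap, ← SetLike.mem_coe, ← Subtype.val_injective.mem_set_image]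
      rw [← V.image_maximalIdeal] at h1
      exact h1
    have h3 := hψ _ h2
    rw [map_sub, map_sub, AlgHom.commutes, AlgHom.commutes, sub_eq_zero] at h3
    exact h3
  · have : (⟨_, hwB i₀⟩ : B) = 1 := Subtype.ext (inv_mul_cancel₀ hzi₀)
    change ψ ⟨_, hwB i₀⟩ ≠ 0
    rw [this, map_one]
    exact one_ne_zero

namespace Filter.Germ

section Algebra

variable {ι R S T : Type*} [CommSemiring R] [CommSemiring S] [CommSemiring T] (l : Filter ι)

theorem eval₂_coe {σ : Type*} (α : R →+* Germ l S) (β : ι → R →+* S)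
    (hαβ : ∀ a, α a = ((fun t => β t a : ι → S) : Germ l S)) (x : ι → σ → S)
    (p : MvPolynomial σ R) :
    eval₂ α (fun i => ((fun t => x t i : ι → S) : Germ l S)) p =
      ((fun t => eval₂ (β t) (x t) p : ι → S) : Germ l S) := by
  induction p using MvPolynomial.induction_on with
  | C a => simp [hαβ]
  | add p q hp hq =>
    simp only [eval₂_add, hp, hq]
    rfl
  | mul_X p i hp =>
    simp only [eval₂_mul, eval₂_X, hp]
    rfl

variable [Algebra R S] [Algebra R T]

noncomputable instance instAlgebra : Algebra R (Germ l S) where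
  algebraMap := (coeRingHom l).comp (algebraMap R (ι → S))
  commutes' _ _ := mul_comm _ _
  smul_def' r x := by
    induction x using Germ.inductionOn with
    | _ f =>
      rw [← coe_smul, Algebra.smul_def]
      rfl

variable (R S) in
/-- The quotient map from functions to germs, as an algebra homomorphism. -/
noncomputable def coeAlgHom : (ι → S) →ₐ[R] Germ l S :=
  { coeRingHom l with commutes' := fun _ => rfl }

/-- The algebra homomorphism on germs induced by an algebra homomorphism. -/
noncomputable def mapAlgHom (g : S →ₐ[R] T) : Germ l S →ₐ[R] Germ l T where
  toFun := Germ.map g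
  map_one' := congrArg (fun f : ι → T => (f : Germ l T)) (funext fun _ => map_one g)
  map_zero' := congrArg (fun f : ι → T => (f : Germ l T)) (funext fun _ => map_zero g)
  map_mul' x y := by
    induction x, y using Germ.inductionOn₂ with
    | _ f h => exact congrArg (fun f : ι → T => (f : Germ l T)) (funext fun _ => map_mul g _ _)
  map_add' x y := by
    induction x, y using Germ.inductionOn₂ with
    | _ f h => exact congrArg (fun f : ι → T => (f : Germ l T)) (funext fun _ => map_add g _ _)
  commutes' r := congrArg (fun f : ι → T => (f : Germ l T)) (funext fun _ => g.commutes r)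

end Algebra

/-- A point of a finitely generated algebra with values in germs comes from a family of points. -/
theorem exists_algHom_coe_eq {ι k V : Type*} [Field k] [CommRing V] [Algebra k V]
    [Algebra.FiniteType k V] (l : Filter ι) [l.NeBot] (g : V →ₐ[k] Germ l k) :
    ∃ φ : ι → V →ₐ[k] k, ∀ a, g a = ((fun t => φ t a : ι → k) : Germ l k) := by
  obtain ⟨r, π, hπ⟩ := Algebra.FiniteType.iff_quotient_mvPolynomial''.1
    (inferInstance : Algebra.FiniteType k V)
  have hz (i : Fin r) : ∃ f : ι → k, g (π (X i)) = f := by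
    induction g (π (X i)) using Germ.inductionOn with
    | _ f => exact ⟨f, rfl⟩
  choose z hz using hz
  have hp (p : MvPolynomial (Fin r) k) :
      g (π p) = ((fun t => aeval (fun i => z i t) p : ι → k) : Germ l k) := by
    have h := eval₂_coe l (algebraMap k (Germ l k)) (fun _ => algebraMap k k) (fun _ => rfl)
      (fun t i => z i t) p
    simp only [← hz] at h
    rw [← AlgHom.comp_apply, aeval_unique (g.comp π)]
    exact h
  obtain ⟨s, hs⟩ : (RingHom.ker π).FG := IsNoetherian.noetherian _
  have hker : ∀ᶠ t in l, ∀ p ∈ s, aeval (fun i => z i t) p = 0 := by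
    rw [Filter.eventually_all_finset]
    intro p hps
    have : π p = 0 := (RingHom.mem_ker).1 (hs ▸ Ideal.subset_span hps)
    exact Germ.coe_eq.1 ((hp p).symm.trans ((congrArg g this).trans (map_zero g)))
  have hex : ∀ᶠ t in l, ∃ φ : V →ₐ[k] k, ∀ p, φ (π p) = aeval (fun i => z i t) p := by
    filter_upwards [hker] with t ht
    have hle : RingHom.ker π ≤ RingHom.ker (aeval (R := k) (fun i => z i t)) := by
      rw [← hs, Ideal.span_le]
      exact ht
    let e := Ideal.quotientKerAlgEquivOfSurjective hπ
    refine ⟨(Ideal.Quotient.liftₐ (RingHom.ker π) (aeval (R := k) (fun i => z i t)) hle).comp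
      (e.symm : V →ₐ[k] _), fun p => ?_⟩
    have : e.symm (π p) = Ideal.Quotient.mk _ p := by
      rw [AlgEquiv.symm_apply_eq]
      rfl
    rw [AlgHom.comp_apply, AlgEquiv.coe_toAlgHom, this]
    exact Ideal.Quotient.liftₐ_apply _ _ _ _
  obtain ⟨t₀, φ₀, -⟩ := hex.exists
  have : Nonempty (V →ₐ[k] k) := ⟨φ₀⟩
  obtain ⟨φ, hφ⟩ := hex.choice
  refine ⟨φ, fun a => ?_⟩
  obtain ⟨p, rfl⟩ := hπ a
  rw [hp, Germ.coe_eq]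
  filter_upwards [hφ] with t ht
  exact (ht p).symm

section TensorProduct

variable {ι k K V W : Type*} [Field k] [Field K] [Algebra k K] [CommRing V] [Algebra k V]
  [CommRing W] [Algebra k W] (l : Filter ι)

variable (k K) in
/-- Constant germs, as an algebra homomorphism. -/
noncomputable def constAlgHom : K →ₐ[k] Germ l K :=
  (coeAlgHom k K l).comp (Pi.constAlgHom k ι K)

/-- The canonical map from `K ⊗ V` to germs of functions with values in `K`, for an algebra `V`
mapping to germs of functions with values in the base field. -/
noncomputable def tensorMap (g : V →ₐ[k] Germ l k) : K ⊗[k] V →ₐ[k] Germ l K :=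
  Algebra.TensorProduct.productMap (constAlgHom k K l) ((mapAlgHom l (Algebra.ofId k K)).comp g)

/-- The base change `K ⊗ V → K` of a `k`-point of `V`. -/
noncomputable def _root_.AlgHom.tensorPoint (φ : V →ₐ[k] k) : K ⊗[k] V →ₐ[k] K :=
  Algebra.TensorProduct.productMap (AlgHom.id k K) ((Algebra.ofId k K).comp φ)

theorem tensorMap_eq_coe (g : V →ₐ[k] Germ l k) (φ : ι → V →ₐ[k] k)
    (h : ∀ a, g a = ((fun t => φ t a : ι → k) : Germ l k)) (a : K ⊗[k] V) :
    tensorMap l g a = ((fun t => (φ t).tensorPoint a : ι → K) : Germ l K) := by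
  induction a with
  | zero => simp only [map_zero]; rfl
  | add a b ha hb => simp only [map_add, ha, hb]; rfl
  | tmul c v =>
    simp only [tensorMap, AlgHom.tensorPoint, Algebra.TensorProduct.productMap_apply_tmul,
      AlgHom.comp_apply, h]
    rfl

theorem tensorMap_injective [l.NeBot] (g : V →ₐ[k] Germ l k) (hg : Function.Injective g) :
    Function.Injective (tensorMap (K := K) l g) := by
  rw [injective_iff_map_eq_zero]
  intro a ha
  let b := Module.Free.chooseBasis k K
  obtain ⟨c, rfl⟩ := (TensorProduct.equivFinsuppOfBasisLeft (N := V) b).symm.surjective a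
  have hf (i) : ∃ f : ι → k, g (c i) = f := by
    induction g (c i) using Germ.inductionOn with
    | _ f => exact ⟨f, rfl⟩
  choose f hf using hf
  have hsum : (TensorProduct.equivFinsuppOfBasisLeft (N := V) b).symm c =
      ∑ i ∈ c.support, b i ⊗ₜ[k] c i := by
    simp [Finsupp.sum]
  have hval : tensorMap l g ((TensorProduct.equivFinsuppOfBasisLeft (N := V) b).symm c) =
      ((∑ i ∈ c.support, fun t => b i * algebraMap k K (f i t) : ι → K) : Germ l K) := by
    have := map_sum (coeRingHom (R := K) l) (fun i t => b i * algebraMap k K (f i t)) c.support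
    refine Eq.trans ?_ this.symm
    rw [hsum, map_sum]
    refine Finset.sum_congr rfl fun i _ => ?_
    simp only [tensorMap, Algebra.TensorProduct.productMap_apply_tmul, AlgHom.comp_apply, hf]
    rfl
  have hev := Germ.coe_eq.1 (hval.symm.trans ha)
  suffices c = 0 by simp [this]
  ext i
  by_contra hi
  have hi' : c i ≠ 0 := hi
  refine hi' ((injective_iff_map_eq_zero g).1 hg _ ?_)
  rw [hf]
  refine Germ.coe_eq.2 ?_
  filter_upwards [hev] with t ht
  have hli := linearIndependent_iff'.1 b.linearIndependent c.support (fun i => f i t)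
  refine hli ?_ i (by simpa using hi')
  simpa [Algebra.smul_def, mul_comm] using ht

theorem tensorMap_comp (g : W →ₐ[k] Germ l k) (j : V →ₐ[k] W) :
    (tensorMap (K := K) l g).comp (Algebra.TensorProduct.map (AlgHom.id k K) j) =
      tensorMap l (g.comp j) := by
  ext <;> simp [tensorMap]

theorem _root_.AlgHom.tensorPoint_comp (φ : W →ₐ[k] k) (j : V →ₐ[k] W) :
    (φ.tensorPoint (K := K)).comp (Algebra.TensorProduct.map (AlgHom.id k K) j) =
      (φ.comp j).tensorPoint := by
  ext <;> simp [AlgHom.tensorPoint]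

end TensorProduct

end Filter.Germ

theorem MonomialOrder.degree_map_of_injective {σ R S : Type*} [CommSemiring R] [CommSemiring S]
    (m : MonomialOrder σ) {g : R →+* S} (hg : Function.Injective g) (p : MvPolynomial σ R) :
    m.degree (map g p) = m.degree p := by
  simp [MonomialOrder.degree, support_map_of_injective p hg]

theorem MonomialOrder.leadingCoeff_map_of_injective {σ R S : Type*} [CommSemiring R]
    [CommSemiring S] (m : MonomialOrder σ) {g : R →+* S} (hg : Function.Injective g)
    (p : MvPolynomial σ R) : m.leadingCoeff (map g p) = g (m.leadingCoeff p) := by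
  rw [MonomialOrder.leadingCoeff, m.degree_map_of_injective hg, coeff_map, MonomialOrder.leadingCoeff]

section Main

/-- The base change of an inclusion of subalgebras. -/
noncomputable abbrev Subalgebra.tensorInclusion {k K F : Type*} [Field k] [Field K] [Algebra k K]
    [CommRing F] [Algebra k F] {A B : Subalgebra k F} (h : A ≤ B) : K ⊗[k] A →ₐ[k] K ⊗[k] B :=
  Algebra.TensorProduct.map (AlgHom.id k K) (Subalgebra.inclusion h)

theorem Subalgebra.tensorInclusion_injective {k K F : Type*} [Field k] [Field K] [Algebra k K]
    [CommRing F] [Algebra k F] {A B : Subalgebra k F} (h : A ≤ B) :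
    Function.Injective (Subalgebra.tensorInclusion (K := K) h) :=
  Module.Flat.lTensor_preserves_injective_linearMap (M := K) (Subalgebra.inclusion h).toLinearMap
    (Subalgebra.inclusion_injective h)

/-- Among the polynomials over the rings `K ⊗ A`, for `A` finitely generated, which vanish at `x`,
finitely many have degrees dominated by all the others. -/
theorem exists_finite_degree_dominating {k K F L : Type*} [Field k] [Field K] [Algebra k K]
    [CommRing F] [Algebra k F] [CommRing L] [Algebra k L] {σ : Type*} [Finite σ]
    (m : MonomialOrder σ) (α : ∀ A : Subalgebra k F, K ⊗[k] A →ₐ[k] L)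
    (hα : ∀ {A B : Subalgebra k F} (h : A ≤ B), (α B).comp (Subalgebra.tensorInclusion h) = α A)
    (x : σ → L) :
    ∃ (A : Subalgebra k F) (D : Set (σ →₀ ℕ)) (f : D → MvPolynomial σ (K ⊗[k] A)), A.FG ∧ D.Finite ∧
      (∀ d, f d ≠ 0 ∧ eval₂ (α A : K ⊗[k] A →+* L) x (f d) = 0 ∧ m.degree (f d) = d) ∧
      ∀ B : Subalgebra k F, B.FG → ∀ p : MvPolynomial σ (K ⊗[k] B), p ≠ 0 →
        eval₂ (α B : K ⊗[k] B →+* L) x p = 0 → ∃ d : D, (d : σ →₀ ℕ) ≤ m.degree p := by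
  let P (d : σ →₀ ℕ) : Prop := ∃ A : Subalgebra k F, A.FG ∧ ∃ f : MvPolynomial σ (K ⊗[k] A),
    f ≠ 0 ∧ eval₂ (α A : K ⊗[k] A →+* L) x f = 0 ∧ m.degree f = d
  have hfin : {d | Minimal P d}.Finite :=
    (setOfPred_minimal_antichain P).finite_of_partiallyWellOrderedOn (Set.isPWO_of_wellQuasiOrderedLE _)
  have hP (d : {d | Minimal P d}) : P d := d.2.prop
  choose A hA f hf0 hfx hfd using hP
  have := hfin.to_subtype
  have hle (d) : A d ≤ ⨆ d, A d := le_iSup A d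
  let j (d) : K ⊗[k] A d →+* K ⊗[k] ↥(⨆ d, A d) := Subalgebra.tensorInclusion (K := K) (hle d)
  have hj (d) : Function.Injective (j d) := Subalgebra.tensorInclusion_injective (hle d)
  refine ⟨⨆ d, A d, {d | Minimal P d}, fun d => map (j d) (f d),
    ?_, hfin, fun d => ⟨?_, ?_, ?_⟩, fun B hB p hp0 hp => ?_⟩
  · have := Fintype.ofFinite {d | Minimal P d}
    rw [← Finset.sup_univ_eq_iSup]
    exact Finset.sup_induction Subalgebra.fg_bot (fun _ h _ h' => h.sup h') fun d _ => hA d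
  · exact (map_eq_zero_iff _ (map_injective _ (hj d))).not.2 (hf0 d)
  · rw [eval₂_map]
    have h := congrArg (fun g : K ⊗[k] A d →ₐ[k] L => (g : K ⊗[k] A d →+* L)) (hα (hle d))
    exact (congrArg (fun g : K ⊗[k] A d →+* L => eval₂ g x (f d)) h).trans (hfx d)
  · exact (m.degree_map_of_injective (hj d) _).trans (hfd d)
  · obtain ⟨d, hd, hmin⟩ := exists_minimal_le_of_wellFoundedLT P (m.degree p)
      ⟨B, hB, p, hp0, hp, rfl⟩
    exact ⟨⟨d, hmin⟩, hd⟩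

/-- For almost every `t`, the point `x t` lies in every tame set containing almost all the points
`x s`. -/
theorem IsTameSet.eventually_forall_mem {ι K : Type*} [Field K] {E : Subfield K} {n : ℕ}
    [IsAlgClosed E] (l : Ultrafilter ι) (x : ι → Fin n → K) :
    ∀ᶠ t in l, ∀ S, IsTameSet E S → (∀ᶠ s in l, x s ∈ S) → x t ∈ S := by
  let F := Germ (l : Filter ι) E
  let L := Germ (l : Filter ι) K
  let xL : Fin n → L := fun i => ((fun t => x t i : ι → K) : L)
  let α (A : Subalgebra E F) : K ⊗[E] A →ₐ[E] L := Germ.tensorMap (l : Filter ι) A.val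
  have hα {A B : Subalgebra E F} (h : A ≤ B) :
      (α B).comp (Subalgebra.tensorInclusion h) = α A := Germ.tensorMap_comp _ _ _
  have hαinj (A : Subalgebra E F) : Function.Injective (α A) :=
    Germ.tensorMap_injective _ _ Subtype.val_injective
  let m : MonomialOrder (Fin n) := MonomialOrder.lex
  obtain ⟨A, D, f, hA, hD, hf, hdom⟩ := exists_finite_degree_dominating m α hα xL
  have := hD.to_subtype
  have : Algebra.FiniteType E A := A.fg_iff_finiteType.1 hA
  obtain ⟨φ, hφ⟩ := Germ.exists_algHom_coe_eq (l : Filter ι) A.val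
  have hαφ := Germ.tensorMap_eq_coe (K := K) (l : Filter ι) A.val φ hφ
  have hvan : ∀ᶠ t in l, ∀ d, eval₂ ((φ t).tensorPoint (K := K) : K ⊗[E] A →+* K) (x t) (f d) = 0 := by
    rw [Filter.eventually_all]
    intro d
    exact Germ.coe_eq.1 ((Germ.eval₂_coe (l : Filter ι) (α A : K ⊗[E] A →+* L)
      (fun t => ((φ t).tensorPoint (K := K) : K ⊗[E] A →+* K)) hαφ x (f d)).symm.trans (hf d).2.1)
  have hlead : ∀ᶠ t in l, ∀ d, (φ t).tensorPoint (K := K) (m.leadingCoeff (f d)) ≠ 0 := by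
    rw [Filter.eventually_all]
    intro d
    rw [Ultrafilter.eventually_not]
    intro h
    refine m.leadingCoeff_ne_zero_iff.2 (hf d).1 ((injective_iff_map_eq_zero (α A)).1 (hαinj A) _ ?_)
    exact (hαφ _).trans (Germ.coe_eq.2 h)
  filter_upwards [hvan, hlead] with t htvan htlead
  rintro S ⟨r, N, -, -, q, hq, rfl⟩ hS
  have hS' : ∀ᶠ s in l, ∃ z : Fin r → E, z ≠ 0 ∧
      ∀ j, eval (Sum.elim (x s) fun i => (z i : K)) (q j) = 0 := by
    filter_upwards [hS]
    rintro s ⟨z, hzE, hz0, hz⟩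
    exact ⟨fun i => ⟨z i, hzE i⟩, fun h => hz0 (funext fun i => congrArg Subtype.val (congrFun h i)),
      hz⟩
  obtain ⟨z, hz⟩ := hS'.choice
  let zF : Fin r → F := fun i => ((fun s => z s i : ι → E) : F)
  have hzF : zF ≠ 0 := by
    intro h
    have h0 : ∀ᶠ s in l, ∀ i, z s i = 0 :=
      Filter.eventually_all.2 fun i => Germ.coe_eq.1 (congrFun h i)
    obtain ⟨s, hs, hs'⟩ := (h0.and hz).exists
    exact hs'.1 (funext hs)
  obtain ⟨B, hAB, hB, ψ, w, c, hψ, hw, i₀, hi₀⟩ :=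
    exists_algHom_extension_ne_zero A hA (φ t) zF hzF
  have hψφ : ψ.comp (Subalgebra.inclusion hAB) = φ t := AlgHom.ext hψ
  let j := (Subalgebra.tensorInclusion hAB : K ⊗[E] A →ₐ[E] K ⊗[E] B)
  have hαj : (α B : K ⊗[E] B →+* L).comp (j : K ⊗[E] A →+* K ⊗[E] B) = α A :=
    congrArg (fun g : K ⊗[E] A →ₐ[E] L => (g : K ⊗[E] A →+* L)) (hα hAB)
  have hψj : ψ.tensorPoint.comp j = (φ t).tensorPoint (K := K) :=
    (AlgHom.tensorPoint_comp ψ (Subalgebra.inclusion hAB)).trans (by rw [hψφ])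
  have hψj' : (ψ.tensorPoint (K := K) : K ⊗[E] B →+* K).comp (j : K ⊗[E] A →+* K ⊗[E] B) =
      (φ t).tensorPoint (K := K) :=
    congrArg (fun g : K ⊗[E] A →ₐ[E] K => (g : K ⊗[E] A →+* K)) hψj
  have hjinj : Function.Injective (j : K ⊗[E] A →+* K ⊗[E] B) :=
    Subalgebra.tensorInclusion_injective hAB
  have htransfer := eval₂_eq_zero_of_degree_dominated m (α B : K ⊗[E] B →+* L)
    (ψ.tensorPoint (K := K) : K ⊗[E] B →+* K) xL (x t)
    (fun d => map (j : K ⊗[E] A →+* K ⊗[E] B) (f d))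
    (fun d => by rw [eval₂_map, hαj]; exact (hf d).2.1)
    (fun d => by rw [eval₂_map, hψj']; exact htvan d)
    (fun d => by
      rw [m.leadingCoeff_map_of_injective hjinj, ← RingHom.comp_apply, hψj']
      exact htlead d)
    (fun p hp0 hp => by
      obtain ⟨d, hd⟩ := hdom B hB p hp0 hp
      exact ⟨d, by rwa [m.degree_map_of_injective hjinj, (hf d).2.2]⟩)
  refine ⟨fun i => (ψ (w i) : K), fun i => (ψ (w i)).2,
    fun h => hi₀ (Subtype.ext (congrFun h i₀)), fun k => ?_⟩
  obtain ⟨d, hqd⟩ := hq k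
  let p : MvPolynomial (Fin n) (K ⊗[E] B) :=
    eval₂ (C.comp Algebra.TensorProduct.includeLeftRingHom)
      (Sum.elim X fun i => C (1 ⊗ₜ w i)) (q k)
  have hp : eval₂ (α B : K ⊗[E] B →+* L) xL p = 0 := by
    let κ : K →+* L := (Germ.constAlgHom E K (l : Filter ι) : K →+* L)
    let μ : F →ₐ[E] L := Germ.mapAlgHom (l : Filter ι) (Algebra.ofId E K)
    have h1 : eval₂ (α B : K ⊗[E] B →+* L) xL p =
        eval₂ κ (Sum.elim xL fun i => μ c * μ (zF i)) (q k) := by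
      rw [← coe_eval₂Hom, hom_eval₂]
      congr 1
      · ext a
        simp [α, κ, Germ.tensorMap]
      · ext (i | i)
        · simp
        · simp [α, μ, Germ.tensorMap, hw]
    have h2 : eval₂ κ (Sum.elim xL fun i => μ (zF i)) (q k) = 0 := by
      have h3 := Germ.eval₂_coe (l : Filter ι) κ (fun _ => RingHom.id K) (fun _ => rfl)
        (fun s => Sum.elim (x s) fun i => (z s i : K)) (q k)
      have h4 : (Sum.elim xL fun i => μ (zF i)) = fun i =>
          ((fun s => Sum.elim (x s) (fun i => (z s i : K)) i : ι → K) : L) := by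
        ext (i | i) <;> rfl
      rw [h4, h3]
      refine Germ.coe_eq.2 ?_
      filter_upwards [hz] with s hs
      exact hs.2 k
    rw [h1, eval₂_sumElim_mul_of_isWeightedHomogeneous κ hqd, h2, mul_zero]
  have hp' := htransfer p hp
  rw [← coe_eval₂Hom, hom_eval₂] at hp'
  rw [← eval₂_id]
  convert hp' using 2
  · ext a
    simp [AlgHom.tensorPoint]
  · ext (i | i)
    · simp
    · simp [AlgHom.tensorPoint, Algebra.ofId_apply]
      rfl

end Main

end Auxiliary

/-- Let `E ⊊ K` be a proper pair of algebraically closed fields and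
`n ≥ 1`. Then the collection of tame subsets of `K^n` satisfies the descending chain
condition: every decreasing chain of tame subsets of `K^n` eventually stabilises. -/
theorem tame_dcc {K : Type*} [Field K] [IsAlgClosed K]
    (E : Subfield K) (hE : IsAlgClosed E) (hEproper : E ≠ ⊤)
    (n : ℕ) (hn : 1 ≤ n)
    (S : ℕ → Set (Fin n → K))
    (hS : ∀ i, IsTameSet E (S i))
    (hchain : ∀ i, S (i + 1) ⊆ S i) :
    ∃ i₀, ∀ i, i₀ ≤ i → S i = S i₀ := by
  by_contra! hcon
  choose M hM hne using hcon
  have hanti : Antitone S := antitone_nat_of_succ_le hchain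
  have hex (i) : ∃ x ∈ S i, x ∉ S (M i) := by
    by_contra! h
    exact hne i ((hanti (hM i)).antisymm h)
  choose x hx hx' using hex
  have : IsAlgClosed E := hE
  obtain ⟨t, ht⟩ := (IsTameSet.eventually_forall_mem (E := E) (Filter.hyperfilter ℕ) x).exists
  refine hx' t (ht _ (hS (M t)) ?_)
  have : ∀ᶠ s in Filter.atTop, x s ∈ S (M t) := by
    filter_upwards [Filter.eventually_ge_atTop (M t)] with s hs using hanti hs (hx s)
  exact Nat.hyperfilter_le_atTop this
end

section
/- Let E ⊊ K be a proper pair of algebraically closed fields and let k be a λ-closed subfield of K. For every tame subset S of K^n defined over k, there exists a Zariski-closed subset V of E^n defined by polynomials with coefficients in k ∩ E such that S ∩ E^n = V. Moreover, if the polynomials q_j defining S are homogeneous in the variables X as well, then the polynomials defining V can be chosen homogeneous. -/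
open MvPolynomial

/-- Homogeneity in the variables `X`. -/
def HomogeneousInX {K : Type*} [Field K] {n r : ℕ}
    (q : MvPolynomial (Fin n ⊕ Fin r) K) : Prop :=
  ∃ d, q.IsWeightedHomogeneous (Sum.elim (fun _ => (1 : ℕ)) (fun _ => 0)) d

/-- The set of λ-values of a subfield `k` of `K` (with respect to the subfield `E`):
all `e ∈ E` for which there are `a₀, a₁, …, a_n ∈ k` (`n ≥ 1`) with `a₁, …, a_n`
linearly independent over `E`, and `e₁, …, e_n ∈ E` with `a₀ = e₁ a₁ + ⋯ + e_n a_n`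
and `e = e₁`. -/
def lambdaSet {K : Type*} [Field K] (E k : Subfield K) : Set K :=
  {e | ∃ (n : ℕ) (a : Fin (n + 1) → K) (a₀ : K) (c : Fin (n + 1) → K),
        (∀ i, a i ∈ k) ∧ a₀ ∈ k ∧
        (∀ b : Fin (n + 1) → K, (∀ i, b i ∈ E) → ∑ i, b i * a i = 0 → ∀ i, b i = 0) ∧
        (∀ i, c i ∈ E) ∧ a₀ = ∑ i, c i * a i ∧ e = c 0}

/-- `λ(k)`: the subfield of `E` generated by the λ-values of `k`. -/
def lambdaSubfield {K : Type*} [Field K] (E k : Subfield K) : Subfield K :=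
  Subfield.closure (lambdaSet E k)

/-- A subfield `k` of `K` is λ-closed if `λ(k) ⊆ k`. -/
def LambdaClosed {K : Type*} [Field K] (E k : Subfield K) : Prop :=
  lambdaSubfield E k ≤ k

section Elimination

/-- The exponents of the monomials of total degree `D`. -/
noncomputable def exponentsOfDegree (τ : Type*) [Finite τ] (D : ℕ) : Finset (τ →₀ ℕ) :=
  ((Finsupp.finite_of_degree_le (σ := τ) D).subset
    (fun μ (hμ : Finsupp.degree μ = D) => hμ.le)).toFinset

theorem mem_exponentsOfDegree {τ : Type*} [Finite τ] {D : ℕ} {μ : τ →₀ ℕ} :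
    μ ∈ exponentsOfDegree τ D ↔ Finsupp.degree μ = D :=
  Set.Finite.mem_toFinset _

open Classical in
/-- A square matrix extracted from the Macaulay matrix in degree `D` of the family `g`:
the column `i` lists the coefficients in degree `D` of a monomial multiple of a member of `g`. -/
noncomputable def macaulayMinor {ι τ R : Type*} [Finite τ] [CommRing R]
    (g : ι → MvPolynomial τ R) (D : ℕ)
    (c : exponentsOfDegree τ D → ι × (τ →₀ ℕ)) : R :=
  (Matrix.of fun (μ i : exponentsOfDegree τ D) =>
    coeff (μ : τ →₀ ℕ) (monomial (c i).2 1 * g (c i).1)).det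

theorem map_macaulayMinor {ι τ R R' : Type*} [Finite τ] [CommRing R] [CommRing R']
    (φ : R →+* R') (g : ι → MvPolynomial τ R) (D : ℕ)
    (c : exponentsOfDegree τ D → ι × (τ →₀ ℕ)) :
    φ (macaulayMinor g D c) = macaulayMinor (fun l => map φ (g l)) D c := by
  classical
  unfold macaulayMinor
  rw [RingHom.map_det]
  congr 1
  ext μ i
  simp only [RingHom.mapMatrix_apply, Matrix.map_apply, Matrix.of_apply, ← coeff_map, map_mul,
    map_monomial, map_one]

theorem isHomogeneous_macaulayMinor {ι σ τ R : Type*} [Finite τ] [CommRing R]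
    (g : ι → MvPolynomial τ (MvPolynomial σ R)) (e : ι → ℕ)
    (hg : ∀ l μ, (coeff μ (g l)).IsHomogeneous (e l)) (D : ℕ)
    (c : exponentsOfDegree τ D → ι × (τ →₀ ℕ)) :
    (macaulayMinor g D c).IsHomogeneous (∑ i, e (c i).1) := by
  classical
  unfold macaulayMinor
  rw [Matrix.det_apply]
  refine IsHomogeneous.sum _ _ _ fun π _ => ?_
  have h : (∏ i, Matrix.of (fun (μ i : exponentsOfDegree τ D) =>
      coeff (μ : τ →₀ ℕ) (monomial (c i).2 1 * g (c i).1)) (π i) i).IsHomogeneous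
        (∑ i, e (c i).1) := by
    refine IsHomogeneous.prod _ _ _ fun i _ => ?_
    rw [Matrix.of_apply, coeff_monomial_mul']
    split_ifs
    · simpa using hg _ _
    · exact isHomogeneous_zero _ _ _
  rcases Int.units_eq_one_or (Equiv.Perm.sign π) with hs | hs
  · rw [hs, one_smul]; exact h
  · rw [hs, Units.neg_smul, one_smul]; exact h.neg

theorem macaulayMinor_eq_zero_of_exists_zero {ι τ R : Type*} [Finite τ] [CommRing R] [IsDomain R]
    (g : ι → MvPolynomial τ R) (hg : ∀ l, ∃ d, (g l).IsHomogeneous d)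
    {ζ : τ → R} (hζ : ζ ≠ 0) (h : ∀ l, eval ζ (g l) = 0) (D : ℕ)
    (c : exponentsOfDegree τ D → ι × (τ →₀ ℕ)) :
    macaulayMinor g D c = 0 := by
  classical
  cases nonempty_fintype τ
  refine Matrix.exists_vecMul_eq_zero_iff.mp
    ⟨fun μ => ∏ j, ζ j ^ (μ : τ →₀ ℕ) j, fun h0 => ?_, ?_⟩
  · obtain ⟨j, hj⟩ := Function.ne_iff.mp hζ
    have hmem : Finsupp.single j D ∈ exponentsOfDegree τ D := by
      simp [mem_exponentsOfDegree]
    have := congrFun h0 ⟨_, hmem⟩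
    simp only [Pi.zero_apply, Finset.prod_eq_zero_iff, Finset.mem_univ, true_and] at this
    obtain ⟨i, hi⟩ := this
    by_cases hij : j = i
    · subst hij
      exact hj (eq_zero_of_pow_eq_zero hi)
    · simp [Finsupp.single_eq_of_ne' hij] at hi
  · ext i
    obtain ⟨d, hd⟩ := hg (c i).1
    have hp : (monomial (c i).2 (1 : R) * g (c i).1).IsHomogeneous
        (Finsupp.degree (c i).2 + d) := (isHomogeneous_monomial _ rfl).mul hd
    have hev : eval ζ (monomial (c i).2 (1 : R) * g (c i).1) = 0 := by
      rw [map_mul, h, mul_zero]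
    simp only [Matrix.vecMul, dotProduct, Matrix.of_apply, Pi.zero_apply]
    generalize monomial (c i).2 (1 : R) * g (c i).1 = p at hp hev
    rw [Finset.sum_coe_sort (exponentsOfDegree τ D)
      (fun μ => (∏ j, ζ j ^ μ j) * coeff μ p)]
    by_cases hD : Finsupp.degree (c i).2 + d = D
    · rw [eval_eq'] at hev
      rw [← hev]
      symm
      refine (Finset.sum_subset (fun μ hμ => ?_) fun μ _ hμ => ?_).trans
        (Finset.sum_congr rfl fun μ _ => mul_comm _ _)
      · rw [mem_exponentsOfDegree, ← hD]
        by_contra hne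
        exact mem_support_iff.mp hμ (hp.coeff_eq_zero hne)
      · rw [notMem_support_iff.mp hμ, zero_mul]
    · refine Finset.sum_eq_zero fun μ hμ => ?_
      rw [hp.coeff_eq_zero, mul_zero]
      rw [mem_exponentsOfDegree.mp hμ]
      exact fun h => hD h.symm

theorem exists_pow_idealOfVars_le {ι τ E : Type*} [Finite τ] [Field E] [IsAlgClosed E]
    (g : ι → MvPolynomial τ E) (h : ∀ ζ : τ → E, (∀ l, eval ζ (g l) = 0) → ζ = 0) :
    ∃ D, idealOfVars τ E ^ D ≤ Ideal.span (Set.range g) := by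
  refine Ideal.exists_pow_le_of_le_radical_of_fg ?_ (idealOfVars_fg τ E)
  rw [← vanishingIdeal_zeroLocus_eq_radical (K := E), idealOfVars, Ideal.span_le]
  rintro _ ⟨j, rfl⟩
  rw [SetLike.mem_coe, mem_vanishingIdeal_iff]
  intro ζ hζ
  rw [zeroLocus_span] at hζ
  have := h ζ fun l => by simpa [aeval_eq_eval] using hζ (g l) ⟨l, rfl⟩
  simp [this]

/-- The coefficients in degree `D`. -/
noncomputable def coeffsOfDegree (τ R : Type*) [Finite τ] [CommRing R] (D : ℕ) :
    MvPolynomial τ R →ₗ[R] (exponentsOfDegree τ D → R) :=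
  LinearMap.pi fun μ => lcoeff R (μ : τ →₀ ℕ)

theorem coeffsOfDegree_mem_span {ι τ R : Type*} [Finite τ] [CommRing R]
    (g : ι → MvPolynomial τ R) (D : ℕ) {p : MvPolynomial τ R}
    (hp : p ∈ Ideal.span (Set.range g)) :
    coeffsOfDegree τ R D p ∈ Submodule.span R (Set.range fun lν : ι × (τ →₀ ℕ) =>
      coeffsOfDegree τ R D (monomial lν.2 1 * g lν.1)) := by
  obtain ⟨a, rfl⟩ := Finsupp.mem_span_range_iff_exists_finsupp.mp hp
  rw [Finsupp.sum, map_sum]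
  refine sum_mem fun l _ => ?_
  rw [(a l).as_sum, Finset.sum_smul, map_sum]
  refine sum_mem fun ν _ => ?_
  have hsmul : monomial ν (coeff ν (a l)) • g l = coeff ν (a l) • (monomial ν 1 * g l) := by
    rw [smul_eq_mul, ← smul_mul_assoc, smul_monomial, smul_eq_mul, mul_one]
  rw [hsmul, map_smul]
  exact Submodule.smul_mem _ _ (Submodule.subset_span ⟨(l, ν), rfl⟩)

theorem exists_zero_of_macaulayMinor_eq_zero {ι τ E : Type*} [Finite τ] [Field E] [IsAlgClosed E]
    (g : ι → MvPolynomial τ E)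
    (h : ∀ D c, macaulayMinor g D c = 0) :
    ∃ ζ : τ → E, ζ ≠ 0 ∧ ∀ l, eval ζ (g l) = 0 := by
  classical
  by_contra! hno
  obtain ⟨D, hD⟩ := exists_pow_idealOfVars_le g fun ζ hζ => by
    by_contra h0
    obtain ⟨l, hl⟩ := hno ζ h0
    exact hl (hζ l)
  set v : ι × (τ →₀ ℕ) → (exponentsOfDegree τ D → E) := fun lν =>
    coeffsOfDegree τ E D (monomial lν.2 1 * g lν.1) with hv
  have hspan : ⊤ ≤ Submodule.span E (Set.range v) := by
    rw [← (Pi.basisFun E (exponentsOfDegree τ D)).span_eq, Submodule.span_le]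
    rintro _ ⟨μ, rfl⟩
    have hmem : monomial (μ : τ →₀ ℕ) (1 : E) ∈ Ideal.span (Set.range g) := by
      refine hD ?_
      rw [monomial_mem_pow_idealOfVars_iff _ _ one_ne_zero, mem_exponentsOfDegree.mp μ.2]
    have hμ : Pi.basisFun E (exponentsOfDegree τ D) μ =
        coeffsOfDegree τ E D (monomial (μ : τ →₀ ℕ) 1) := by
      ext μ'
      simp only [Pi.basisFun_apply, Pi.single_apply, coeffsOfDegree, LinearMap.pi_apply,
        lcoeff_apply, coeff_monomial, Subtype.ext_iff, eq_comm (a := (μ : τ →₀ ℕ))]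
    rw [SetLike.mem_coe, hμ]
    exact coeffsOfDegree_mem_span g D hmem
  obtain ⟨κ, a, -, ha, hli⟩ := exists_linearIndependent' E v
  let b := Module.Basis.mk hli (hspan.trans ha.ge)
  let e := b.indexEquiv (Pi.basisFun E (exponentsOfDegree τ D))
  have hcols := hli.comp e.symm e.symm.injective
  have hu := Matrix.linearIndependent_cols_iff_isUnit.mp
    (show LinearIndependent E (Matrix.of fun (μ i : exponentsOfDegree τ D) =>
      coeff (μ : τ →₀ ℕ) (monomial (a (e.symm i)).2 1 * g (a (e.symm i)).1)).col from hcols)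
  rw [Matrix.isUnit_iff_isUnit_det] at hu
  exact hu.ne_zero (h D fun i => a (e.symm i))

/-- A polynomial in two groups of variables, seen as a polynomial in the second group. -/
noncomputable def collectRight {σ τ F : Type*} [CommRing F] :
    MvPolynomial (σ ⊕ τ) F →ₐ[F] MvPolynomial τ (MvPolynomial σ F) :=
  aeval (Sum.elim (fun i => C (X i)) X)

theorem collectRight_monomial {σ τ F : Type*} [CommRing F] (u : σ →₀ ℕ) (v : τ →₀ ℕ) (a : F) :
    collectRight (monomial (u.sumElim v) a) = monomial v (monomial u a) := by
  rw [collectRight, aeval_monomial, Finsupp.prod_sumElim, monomial_eq (s := v),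
    monomial_eq (s := u), ← mul_assoc, map_mul]
  congr 2
  rw [Finsupp.prod, Finsupp.prod, map_prod]
  simp

theorem map_aeval_collectRight {σ τ F E : Type*} [CommRing F] [CommRing E] [Algebra F E]
    (x : σ → E) (ζ : τ → E) (f : MvPolynomial (σ ⊕ τ) F) :
    eval ζ (map (aeval x : MvPolynomial σ F →ₐ[F] E) (collectRight f)) = aeval (Sum.elim x ζ) f := by
  induction f using MvPolynomial.induction_on with
  | C a => simp [collectRight]
  | add p q hp hq => simp only [map_add, hp, hq]
  | mul_X p i hp =>
    rw [map_mul, map_mul, map_mul, map_mul, hp]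
    cases i <;> simp [collectRight]

theorem weight_one_zero_sumElim {σ τ : Type*} (u : σ →₀ ℕ) (v : τ →₀ ℕ) :
    Finsupp.weight (Sum.elim (fun _ => (1 : ℕ)) (fun _ => 0)) (u.sumElim v) = u.degree := by
  rw [Finsupp.weight_apply, Finsupp.sum_sumElim]
  simp [Finsupp.sum, Finsupp.degree_apply]

theorem weight_zero_one_sumElim {σ τ : Type*} (u : σ →₀ ℕ) (v : τ →₀ ℕ) :
    Finsupp.weight (Sum.elim (fun _ => (0 : ℕ)) (fun _ => 1)) (u.sumElim v) = v.degree := by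
  rw [Finsupp.weight_apply, Finsupp.sum_sumElim]
  simp [Finsupp.sum, Finsupp.degree_apply]

theorem isHomogeneous_collectRight {σ τ F : Type*} [CommRing F] {f : MvPolynomial (σ ⊕ τ) F}
    {d : ℕ} (hf : f.IsWeightedHomogeneous (Sum.elim (fun _ => (0 : ℕ)) (fun _ => 1)) d) :
    (collectRight f).IsHomogeneous d := by
  rw [f.as_sum, map_sum]
  refine IsHomogeneous.sum _ _ _ fun w hw => ?_
  obtain ⟨⟨u, v⟩, rfl⟩ := Finsupp.sumFinsuppEquivProdFinsupp.symm.surjective w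
  change (u.sumElim v) ∈ f.support at hw
  change (collectRight (monomial (u.sumElim v) _)).IsHomogeneous d
  rw [collectRight_monomial]
  refine isHomogeneous_monomial _ ?_
  rw [← weight_zero_one_sumElim u v]
  exact hf (mem_support_iff.mp hw)

theorem isHomogeneous_coeff_collectRight {σ τ F : Type*} [CommRing F]
    {f : MvPolynomial (σ ⊕ τ) F} {e : ℕ}
    (hf : f.IsWeightedHomogeneous (Sum.elim (fun _ => (1 : ℕ)) (fun _ => 0)) e) (μ : τ →₀ ℕ) :
    (coeff μ (collectRight f)).IsHomogeneous e := by
  classical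
  rw [f.as_sum, map_sum, coeff_sum]
  refine IsHomogeneous.sum _ _ _ fun w hw => ?_
  obtain ⟨⟨u, v⟩, rfl⟩ := Finsupp.sumFinsuppEquivProdFinsupp.symm.surjective w
  change (u.sumElim v) ∈ f.support at hw
  change (coeff μ (collectRight (monomial (u.sumElim v) _))).IsHomogeneous e
  rw [collectRight_monomial, coeff_monomial]
  split_ifs
  · refine isHomogeneous_monomial _ ?_
    rw [← weight_one_zero_sumElim u v]
    exact hf (mem_support_iff.mp hw)
  · exact isHomogeneous_zero _ _ _

/-- The main theorem of elimination theory, over an algebraically closed extension `E` of the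
field of definition `F`. -/
theorem exists_finset_forall_exists_zero_iff {ι σ τ F E : Type*} [Finite σ] [Finite τ] [Field F]
    [Field E] [IsAlgClosed E] [Algebra F E] (f : ι → MvPolynomial (σ ⊕ τ) F)
    (hf : ∀ l, ∃ d, (f l).IsWeightedHomogeneous
      (Sum.elim (fun _ => (0 : ℕ)) (fun _ => 1)) d) :
    ∃ T : Finset (MvPolynomial σ F),
      (∀ x : σ → E, (∃ ζ : τ → E, ζ ≠ 0 ∧ ∀ l, aeval (Sum.elim x ζ) (f l) = 0) ↔
        ∀ p ∈ T, aeval x p = 0) ∧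
      ((∀ l, ∃ e, (f l).IsWeightedHomogeneous (Sum.elim (fun _ => (1 : ℕ)) (fun _ => 0)) e) →
        ∀ p ∈ T, ∃ e, p.IsHomogeneous e) := by
  set g : ι → MvPolynomial τ (MvPolynomial σ F) := fun l => collectRight (f l)
  set P : Set (MvPolynomial σ F) :=
    Set.range fun Dc : Σ D, exponentsOfDegree τ D → ι × (τ →₀ ℕ) => macaulayMinor g Dc.1 Dc.2
  obtain ⟨T, hTP, hT⟩ := (Submodule.fg_span_iff_fg_span_finset_subset P).mp
    (IsNoetherian.noetherian (Ideal.span P))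
  refine ⟨T, fun x => ?_, fun he p hp => ?_⟩
  · set φ : MvPolynomial σ F →+* E := RingHomClass.toRingHom (aeval (R := F) x) with hφ
    have hspan (A : Set (MvPolynomial σ F)) :
        (∀ p ∈ A, aeval x p = 0) ↔ Ideal.span A ≤ RingHom.ker φ := by
      rw [Ideal.span_le]
      rfl
    have hx : (∀ p ∈ T, aeval x p = 0) ↔
        ∀ D c, macaulayMinor (fun l => map φ (g l)) D c = 0 := by
      refine (hspan T).trans ((iff_of_eq (congrArg (· ≤ _) hT.symm)).trans
        ((hspan P).symm.trans ?_))
      simp only [P, Set.forall_mem_range, Sigma.forall, ← map_macaulayMinor]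
      rfl
    simp only [hx, ← map_aeval_collectRight, ← hφ]
    constructor
    · rintro ⟨ζ, hζ, h⟩
      refine macaulayMinor_eq_zero_of_exists_zero _ (fun l => ?_) hζ h
      obtain ⟨d, hd⟩ := hf l
      exact ⟨d, (isHomogeneous_collectRight hd).map _⟩
    · exact exists_zero_of_macaulayMinor_eq_zero _
  · obtain ⟨⟨D, c⟩, rfl⟩ := hTP hp
    choose e he using he
    exact ⟨_, isHomogeneous_macaulayMinor g e
      (fun l => isHomogeneous_coeff_collectRight (he l)) D c⟩

end Elimination

section LambdaClosed

theorem LambdaClosed.coeff_mem {K : Type*} [Field K] {E k : Subfield K} (hk : LambdaClosed E k)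
    {n : ℕ} {a : Fin n → K} (ha : ∀ i, a i ∈ k) (hli : LinearIndependent E a)
    (c : Fin n → E) (hc : ∑ i, c i • a i ∈ k) (i : Fin n) : (c i : K) ∈ k := by
  obtain _ | n := n
  · exact i.elim0
  refine hk (Subfield.subset_closure ⟨n, a ∘ Equiv.swap 0 i, ∑ i, c i • a i,
    fun j => (c (Equiv.swap 0 i j) : K), fun j => ha _, hc, ?_, fun j => (c _).2, ?_, by simp⟩)
  · intro b hb hsum j
    have h := Fintype.linearIndependent_iff.mp
      (hli.comp (Equiv.swap 0 i) (Equiv.swap 0 i).injective) (fun j => ⟨b j, hb j⟩) hsum j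
    exact congrArg Subtype.val h
  · exact (Equiv.sum_comp (Equiv.swap 0 i) fun j => (c j : K) * a j).symm

/-- A λ-closed subfield `k` is linearly disjoint from `E` over `k ⊓ E`. -/
theorem LambdaClosed.linearIndependent {K : Type*} [Field K] {E k : Subfield K}
    (hk : LambdaClosed E k) {β : Type*} {b : β → K} (hb : ∀ i, b i ∈ k)
    (hli : LinearIndependent (k ⊓ E : Subfield K) b) : LinearIndependent E b := by
  have hfin : ∀ (n : ℕ) (a : Fin n → K), (∀ i, a i ∈ k) →
      LinearIndependent (k ⊓ E : Subfield K) a → LinearIndependent E a := by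
    intro n
    induction n with
    | zero => exact fun a _ _ => linearIndependent_empty_type
    | succ n ih =>
      intro a
      refine Fin.consCases (fun x v => ?_) a
      intro ha hF
      obtain ⟨hv, hx⟩ := linearIndependent_finCons.mp hF
      have hvk : ∀ i, v i ∈ k := fun i => by simpa using ha i.succ
      have hvE := ih v hvk hv
      refine linearIndependent_finCons.mpr ⟨hvE, fun hxE => hx ?_⟩
      obtain ⟨c, rfl⟩ := (Submodule.mem_span_range_iff_exists_fun E).mp hxE
      have hc := hk.coeff_mem hvk hvE c (by simpa using ha 0)
      exact (Submodule.mem_span_range_iff_exists_fun _).mpr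
        ⟨fun i => ⟨c i, hc i, (c i).2⟩, rfl⟩
  rw [linearIndependent_iff_finset_linearIndependent] at hli ⊢
  intro s
  exact (linearIndependent_equiv s.equivFin.symm).mp
    (hfin _ _ (fun i => hb _) ((hli s).comp s.equivFin.symm s.equivFin.symm.injective))

universe u in
/-- Over a λ-closed subfield `k`, the vanishing of a polynomial at points of `E` is expressed by
polynomials over `k ⊓ E`. -/
theorem LambdaClosed.exists_polynomials_iff {K : Type u} [Field K] {E k : Subfield K}
    (hk : LambdaClosed E k) [Algebra (k ⊓ E : Subfield K) E]
    [IsScalarTower (k ⊓ E : Subfield K) E K] {σ : Type*} {q : MvPolynomial σ K}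
    (hq : ∀ d, coeff d q ∈ k) :
    ∃ (β : Type u) (f : β → MvPolynomial σ (k ⊓ E : Subfield K)),
      (∀ y : σ → E, eval (fun i => (y i : K)) q = 0 ↔ ∀ i, aeval y (f i) = 0) ∧
      ∀ (w : σ → ℕ) (m : ℕ), q.IsWeightedHomogeneous w m →
        ∀ i, (f i).IsWeightedHomogeneous w m := by
  let V : Submodule (k ⊓ E : Subfield K) K :=
    { carrier := k
      add_mem' := k.add_mem
      zero_mem' := k.zero_mem
      smul_mem' := fun c _ hx => k.mul_mem c.2.1 hx }
  let b := Module.Basis.ofVectorSpace (k ⊓ E : Subfield K) V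
  have hli : LinearIndependent E fun i => (b i : K) :=
    hk.linearIndependent (fun i => (b i).2) (b.linearIndependent.map' V.subtype V.ker_subtype)
  let v (d : σ →₀ ℕ) := b.repr ⟨coeff d q, hq d⟩
  refine ⟨_, fun i => ∑ d ∈ q.support, monomial d (v d i), fun y => ?_, fun w m hqm i => ?_⟩
  · let s : _ →₀ E := ∑ d ∈ q.support, (d.prod fun j e => y j ^ e) •
      (v d).mapRange (algebraMap (k ⊓ E : Subfield K) E) (map_zero _)
    have hs : Finsupp.linearCombination E (fun i => (b i : K)) s =
        eval (fun i => (y i : K)) q := by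
      rw [eval_eq, map_sum]
      refine Finset.sum_congr rfl fun d _ => ?_
      have hv : Finsupp.linearCombination E (fun i => (b i : K))
          ((v d).mapRange (algebraMap (k ⊓ E : Subfield K) E) (map_zero _)) = coeff d q := by
        have h := congrArg V.subtype (b.linearCombination_repr ⟨coeff d q, hq d⟩)
        rw [Finsupp.apply_linearCombination, Finsupp.linearCombination_apply] at h
        rw [Finsupp.linearCombination_apply, Finsupp.sum_mapRange_index (by simp)]
        simp only [algebraMap_smul]
        exact h
      rw [map_smul, hv, Algebra.smul_def, mul_comm, Finsupp.prod, map_prod]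
      simp only [map_pow]
      rfl
    rw [← hs, (linearIndependent_iff_injective_finsuppLinearCombination.mp hli).eq_iff'
      (map_zero _), Finsupp.ext_iff]
    refine forall_congr' fun i => ?_
    simp only [s, Finsupp.finsetSum_apply, Finsupp.smul_apply, Finsupp.mapRange_apply, map_sum,
      aeval_monomial, smul_eq_mul, mul_comm, Finsupp.coe_zero, Pi.zero_apply]
  · exact IsWeightedHomogeneous.sum _ _ _ fun _ hd =>
      isWeightedHomogeneous_monomial _ _ _ (hqm (mem_support_iff.mp hd))

end LambdaClosed

/-- Let `E ⊊ K` be a proper pair of algebraically closed fields and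
`k` a λ-closed subfield of `K`. For every tame subset `S` of `K^n` defined over `k`
(by polynomials `q j` with coefficients in `k`, homogeneous in the variables `Z`),
there is a Zariski-closed subset of `E^n` defined by polynomials with coefficients in
`k ∩ E` whose `E`-points are exactly `S ∩ E^n`; moreover, if the `q j` are also
homogeneous in the variables `X`, the defining polynomials may be chosen homogeneous. -/
theorem tame_trace_on_E {K : Type*} [Field K] [IsAlgClosed K]
    (E : Subfield K) (hE : IsAlgClosed E) (hEproper : E ≠ ⊤)
    (k : Subfield K) (hk : LambdaClosed E k)
    (n r m : ℕ) (hr : 0 < r) (hm : 0 < m)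
    (q : Fin m → MvPolynomial (Fin n ⊕ Fin r) K)
    (hqk : ∀ j d, coeff d (q j) ∈ k)
    (hqh : ∀ j, HomogeneousInZ (q j))
    (S : Set (Fin n → K))
    (hS : S = {x | ∃ ζ : Fin r → K, (∀ i, ζ i ∈ E) ∧ ζ ≠ 0 ∧
            ∀ j, MvPolynomial.eval (Sum.elim x ζ) (q j) = 0}) :
    (∃ (m' : ℕ) (p : Fin m' → MvPolynomial (Fin n) K),
        (∀ j d, coeff d (p j) ∈ k ⊓ E) ∧
        ∀ x : Fin n → K, (∀ i, x i ∈ E) →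
          (x ∈ S ↔ ∀ j, MvPolynomial.eval x (p j) = 0)) ∧
    ((∀ j, HomogeneousInX (q j)) →
      ∃ (m' : ℕ) (p : Fin m' → MvPolynomial (Fin n) K),
        (∀ j d, coeff d (p j) ∈ k ⊓ E) ∧
        (∀ j, ∃ d, (p j).IsHomogeneous d) ∧
        ∀ x : Fin n → K, (∀ i, x i ∈ E) →
          (x ∈ S ↔ ∀ j, MvPolynomial.eval x (p j) = 0)) := by
  let F : Subfield K := k ⊓ E
  let : Algebra F E := (Subfield.inclusion (inf_le_right : F ≤ E)).toAlgebra
  have : IsScalarTower F E K := .of_algebraMap_eq fun _ => rfl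
  have := hE
  choose β g hg hgh using fun j => hk.exists_polynomials_iff (hqk j)
  obtain ⟨T, hT, hTh⟩ := exists_finset_forall_exists_zero_iff (E := E)
    (fun l : Σ j, β j => g l.1 l.2) fun l => (hqh l.1).imp fun _ hd => hgh _ _ _ hd _
  let p (j : Fin T.card) : MvPolynomial (Fin n) K :=
    map (algebraMap F K) (T.equivFin.symm j : MvPolynomial (Fin n) F)
  have hp : ∀ j d, coeff d (p j) ∈ k ⊓ E := fun j d => by
    rw [coeff_map]
    exact (coeff d (T.equivFin.symm j : MvPolynomial (Fin n) F)).2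
  have hS' : ∀ x : Fin n → K, (∀ i, x i ∈ E) → (x ∈ S ↔ ∀ j, eval x (p j) = 0) := by
    intro x hx
    obtain ⟨x, rfl⟩ : ∃ y : Fin n → E, x = fun i => (y i : K) := ⟨fun i => ⟨x i, hx i⟩, rfl⟩
    have hpT : (∀ j, eval (fun i => (x i : K)) (p j) = 0) ↔ ∀ f ∈ T, aeval x f = 0 := by
      rw [T.equivFin.symm.forall_congr_left, Equiv.symm_symm, Subtype.forall]
      refine forall₂_congr fun f hf => ?_
      simp only [p, Equiv.symm_apply_apply]
      rw [eval_map, ← aeval_def,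
        ← map_eq_zero_iff (algebraMap E K) (algebraMap E K).injective, ← aeval_algebraMap_apply]
      rfl
    have hg' (ζ : Fin r → E) :
        (∀ l : Σ j, β j, aeval (Sum.elim x ζ) (g l.1 l.2) = 0) ↔
          ∀ j, eval (Sum.elim (fun i => (x i : K)) fun i => (ζ i : K)) (q j) = 0 := by
      rw [Sigma.forall]
      refine forall_congr' fun j => (hg j _).symm.trans ?_
      rw [show (fun i => ((Sum.elim x ζ i : E) : K)) =
        Sum.elim (fun i => (x i : K)) fun i => (ζ i : K) by ext (_ | _) <;> rfl]
    rw [hpT, ← hT, hS]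
    simp only [hg']
    constructor
    · rintro ⟨ζ, hζ, h0, h⟩
      exact ⟨fun i => ⟨ζ i, hζ i⟩,
        fun h => h0 (funext fun i => congrArg Subtype.val (congrFun h i)), h⟩
    · rintro ⟨ζ, h0, h⟩
      exact ⟨fun i => ζ i, fun i => (ζ i).2,
        fun h => h0 (funext fun i => Subtype.ext (congrFun h i)), h⟩
  refine ⟨⟨_, p, hp, hS'⟩, fun hX => ⟨_, p, hp, fun j => ?_, hS'⟩⟩
  exact (hTh (fun l => (hX l.1).imp fun _ hd => hgh _ _ _ hd _) _ (T.equivFin.symm j).2).imp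
    fun _ h => h.map _
end

section
/- Let F be a field and J a homogeneous ideal of the polynomial ring F[X_0, …, X_n]. Then there exists a degree d_0 such that J_d = Sat(J)_d for all d ≥ d_0; that is, the homogeneous ideal J and its saturation Sat(J) have the same homogeneous components in all sufficiently large degrees. -/
open MvPolynomial

/-- An ideal of the polynomial ring is homogeneous if it contains all the homogeneous
components of its members. -/
def HomogIdeal {F : Type*} [Field F] {n : ℕ}
    (J : Ideal (MvPolynomial (Fin (n + 1)) F)) : Prop :=
  ∀ p ∈ J, ∀ i : ℕ, MvPolynomial.homogeneousComponent i p ∈ J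

/-- Multiplication by a form of degree `a` shifts homogeneous components by `a`. -/
theorem homogeneousComponent_add_isHomogeneous_mul {σ R : Type*} [CommSemiring R] {a : ℕ}
    {f : MvPolynomial σ R} (hf : f.IsHomogeneous a) (e : ℕ) (q : MvPolynomial σ R) :
    homogeneousComponent (a + e) (f * q) = f * homogeneousComponent e q := by
  conv_lhs => rw [← sum_homogeneousComponent q, Finset.mul_sum, map_sum]
  have hterm (k : ℕ) : homogeneousComponent (a + e) (f * homogeneousComponent k q) =
      if k = e then f * homogeneousComponent e q else 0 := by
    rw [homogeneousComponent_of_mem (hf.mul (homogeneousComponent_isHomogeneous k q))]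
    by_cases h : k = e
    · simp [h]
    · simp [h, Ne.symm h]
  simp only [hterm, Finset.sum_ite_eq', Finset.mem_range]
  split_ifs with h
  · rfl
  · rw [homogeneousComponent_eq_zero _ _ (by omega), mul_zero]

/-- If powers of all variables multiply `q` into the homogeneous ideal `J`, then the components
of large degree of the multiples of `q` lie in `J`, uniformly in the multiplier. -/
theorem HomogIdeal.exists_homogeneousComponent_mul_mem {F : Type*} [Field F] {n : ℕ}
    {J : Ideal (MvPolynomial (Fin (n + 1)) F)} (hJ : HomogIdeal J)
    {q : MvPolynomial (Fin (n + 1)) F}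
    (hq : ∃ D : ℕ, ∀ i : Fin (n + 1), (X i : MvPolynomial (Fin (n + 1)) F) ^ D * q ∈ J) :
    ∃ d₀ : ℕ, ∀ d : ℕ, d₀ ≤ d → ∀ g : MvPolynomial (Fin (n + 1)) F,
      homogeneousComponent d (g * q) ∈ J := by
  obtain ⟨D, hD⟩ := hq
  refine ⟨(n + 1) * D + q.totalDegree, fun d hd g => ?_⟩
  induction g using MvPolynomial.induction_on' with
  | add f g hf hg =>
    rw [add_mul, map_add]
    exact J.add_mem hf hg
  | monomial m c =>
    rw [← sum_homogeneousComponent q, Finset.mul_sum, map_sum]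
    refine J.sum_mem fun e he => ?_
    rw [Finset.mem_range] at he
    have hm : (monomial m c).IsHomogeneous m.degree := isHomogeneous_monomial c rfl
    rw [homogeneousComponent_of_mem (hm.mul (homogeneousComponent_isHomogeneous e q))]
    split_ifs with hde
    · obtain ⟨i, hi⟩ : ∃ i, D ≤ m i := by
        by_contra! h
        have : m.degree < (n + 1) * D := by
          rw [Finsupp.degree_eq_sum]
          simpa using Finset.sum_lt_sum_of_nonempty (Finset.univ_nonempty) fun i _ => h i
        omega
      have hX : (X i : MvPolynomial (Fin (n + 1)) F) ^ D * homogeneousComponent e q ∈ J := by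
        rw [← homogeneousComponent_add_isHomogeneous_mul (isHomogeneous_X_pow i D)]
        exact hJ _ (hD i) _
      have hdvd : (X i : MvPolynomial (Fin (n + 1)) F) ^ D ∣ monomial m c := by
        rw [X_pow_eq_monomial, monomial_dvd_monomial]
        exact ⟨Or.inr (by simpa using hi), one_dvd c⟩
      exact J.mem_of_dvd (mul_dvd_mul_right hdvd _) hX
    · exact J.zero_mem

/-- Let `F` be a field and `J` a homogeneous ideal of
`F[X₀, …, X_n]`. Then there is a degree `d₀` such that `J_d = Sat(J)_d` for all
`d ≥ d₀`: a homogeneous polynomial `p` of degree `d ≥ d₀` lies in `J` if and only if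
`X_i ^ D * p ∈ J` for all `i` and some `D`. -/
theorem saturation_agrees_in_large_degree {F : Type*} [Field F] (n : ℕ)
    (J : Ideal (MvPolynomial (Fin (n + 1)) F)) (hJ : HomogIdeal J) :
    ∃ d₀ : ℕ, ∀ d : ℕ, d₀ ≤ d → ∀ p : MvPolynomial (Fin (n + 1)) F,
      p.IsHomogeneous d →
      (p ∈ J ↔ ∃ D : ℕ, ∀ i : Fin (n + 1), (X i : MvPolynomial (Fin (n + 1)) F) ^ D * p ∈ J) := by
  obtain ⟨T, hTS, hT⟩ := (Submodule.fg_span_iff_fg_span_finset_subset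
    (R := MvPolynomial (Fin (n + 1)) F)
    {p : MvPolynomial (Fin (n + 1)) F | ∃ D : ℕ, ∀ i, X i ^ D * p ∈ J}).1
      (IsNoetherian.noetherian _)
  choose! b hb using fun q (hq : q ∈ T) => hJ.exists_homogeneousComponent_mul_mem (hTS hq)
  refine ⟨T.sup b, fun d hd p hp => ⟨fun h => ⟨0, fun i => J.mul_mem_left _ h⟩, fun h => ?_⟩⟩
  have key : ∀ g, homogeneousComponent d (g * p) ∈ J := by
    have hpT : p ∈ Submodule.span (MvPolynomial (Fin (n + 1)) F) (T : Set _) :=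
      hT ▸ Submodule.subset_span h
    clear hp h
    induction hpT using Submodule.span_induction with
    | mem q hq => exact hb q hq d ((Finset.le_sup hq).trans hd)
    | zero => simp
    | add x y _ _ hx hy =>
      intro g
      rw [mul_add, map_add]
      exact J.add_mem (hx g) (hy g)
    | smul a x _ hx =>
      intro g
      rw [smul_eq_mul, ← mul_assoc]
      exact hx (g * a)
  simpa [homogeneousComponent_of_mem hp] using key 1
end

section
/- Let F be a field and let J and J' be saturated homogeneous ideals of F[X_0, …, X_n]. If J_d = J'_d for infinitely many degrees d, then J = J'. -/
open MvPolynomial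

/-- A homogeneous ideal is saturated if every homogeneous polynomial `p` such that
`X_i ^ D * p ∈ I` for all `i` and some `D` already belongs to `I`. -/
def SaturatedIdeal {F : Type*} [Field F] {n : ℕ}
    (J : Ideal (MvPolynomial (Fin (n + 1)) F)) : Prop :=
  ∀ p : MvPolynomial (Fin (n + 1)) F, (∃ d, p.IsHomogeneous d) →
    (∃ D : ℕ, ∀ i : Fin (n + 1), (X i : MvPolynomial (Fin (n + 1)) F) ^ D * p ∈ J) →
    p ∈ J

/-- If `J` is homogeneous, `J'` is saturated and `J_d ⊆ J'_d` for infinitely many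
degrees `d`, then `J ≤ J'`. -/
theorem le_of_infinitely_many_degrees {F : Type*} [Field F] {n : ℕ}
    {J J' : Ideal (MvPolynomial (Fin (n + 1)) F)}
    (hJ : HomogIdeal J) (hJ's : SaturatedIdeal J')
    (h : {d : ℕ | ∀ p : MvPolynomial (Fin (n + 1)) F,
        p.IsHomogeneous d → p ∈ J → p ∈ J'}.Infinite) :
    J ≤ J' := by
  intro p hp
  rw [← sum_homogeneousComponent p]
  refine Ideal.sum_mem _ fun i _ => ?_
  have hi := homogeneousComponent_isHomogeneous i p
  obtain ⟨e, he, hie⟩ := h.exists_gt i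
  refine hJ's _ ⟨i, hi⟩ ⟨e - i, fun j => he _ ?_ (J.mul_mem_left _ (hJ p hp i))⟩
  have hmul := (isHomogeneous_X_pow (R := F) j (e - i)).mul hi
  rwa [Nat.sub_add_cancel hie.le] at hmul

/-- Let `F` be a field and `J`, `J'` saturated homogeneous ideals of
`F[X₀, …, X_n]`. If `J_d = J'_d` for infinitely many degrees `d`, then `J = J'`. -/
theorem saturated_ideals_eq_of_infinitely_many_degrees {F : Type*} [Field F] (n : ℕ)
    (J J' : Ideal (MvPolynomial (Fin (n + 1)) F))
    (hJ : HomogIdeal J) (hJ' : HomogIdeal J')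
    (hJs : SaturatedIdeal J) (hJ's : SaturatedIdeal J')
    (h : {d : ℕ | ∀ p : MvPolynomial (Fin (n + 1)) F,
        p.IsHomogeneous d → (p ∈ J ↔ p ∈ J')}.Infinite) :
    J = J' := by
  exact le_antisymm
    (le_of_infinitely_many_degrees hJ hJ's (h.mono fun _ hd p hp => (hd p hp).1))
    (le_of_infinitely_many_degrees hJ' hJs (h.mono fun _ hd p hp => (hd p hp).2))
end

section
/- Let E ⊊ K be a proper pair of algebraically closed fields and let k ⊆ L be subfields of K. Then L and E are algebraically free over the compositum λ(k)·k (i.e. every finite tuple from L that is algebraically independent over λ(k)·k remains algebraically independent over the compositum of E and λ(k)·k) if and only if every element of λ(L) is algebraic over λ(k). -/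
open MvPolynomial

/-- A tuple `x` of elements of `K` is algebraically independent over a subfield `F`:
no nonzero polynomial with coefficients in `F` vanishes at `x`. -/
def AlgIndepOver {K : Type*} [Field K] (F : Subfield K) {m : ℕ} (x : Fin m → K) : Prop :=
  ∀ p : MvPolynomial (Fin m) K, (∀ d, coeff d p ∈ F) → MvPolynomial.eval x p = 0 → p = 0

/-- The subfields `B` and `C` of `K` are algebraically free over `A`: every finite tuple
from `B` which is algebraically independent over `A` remains algebraically independent
over the compositum `A·C`. -/
def AlgFree {K : Type*} [Field K] (A B C : Subfield K) : Prop :=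
  ∀ (m : ℕ) (x : Fin m → K), (∀ i, x i ∈ B) → AlgIndepOver A x → AlgIndepOver (A ⊔ C) x

/-- An element `e` of `K` is algebraic over the subfield `F`. -/
def AlgebraicOver {K : Type*} [Field K] (F : Subfield K) (e : K) : Prop :=
  ∃ p : Polynomial K, p ≠ 0 ∧ (∀ i, p.coeff i ∈ F) ∧ Polynomial.eval e p = 0

/-- The subfield of `K` generated by a subfield `k` and the entries of a tuple `a`. -/
def adjoinTuple {K : Type*} [Field K] (k : Subfield K) {n : ℕ} (a : Fin n → K) :
    Subfield K :=
  Subfield.closure (↑k ∪ Set.range a)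

/-- A finitely generated algebra inside a field over an algebraically closed field has a
rational point. -/
theorem nonempty_algHom_adjoin_of_finite {F E : Type*} [Field F] [IsAlgClosed F] [Field E]
    [Algebra F E] (s : Set E) (hs : s.Finite) :
    Nonempty (Algebra.adjoin F s →ₐ[F] F) := by
  let A := Algebra.adjoin F s
  have : Algebra.FiniteType F A := (Subalgebra.fg_iff_finiteType A).1
    ⟨hs.toFinset, by simp [A]⟩
  obtain ⟨m, hm⟩ := Ideal.exists_maximal A
  let := Ideal.Quotient.field m
  have : Module.Finite F (A ⧸ m) := finite_of_finite_type_of_isJacobsonRing F (A ⧸ m)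
  let e : F ≃ₐ[F] (A ⧸ m) := AlgEquiv.ofBijective (Algebra.ofId F (A ⧸ m))
    IsAlgClosed.algebraMap_bijective_of_isIntegral
  exact ⟨e.symm.toAlgHom.comp (Ideal.Quotient.mkₐ F m)⟩

open scoped TensorProduct in
/-- Over an algebraically closed field, the tensor product of two field extensions is a domain. -/
theorem TensorProduct.noZeroDivisors_of_isAlgClosed {F E L : Type*} [Field F] [IsAlgClosed F]
    [Field E] [Field L] [Algebra F E] [Algebra F L] : NoZeroDivisors (E ⊗[F] L) := by
  classical
  let b := Module.Basis.ofVectorSpace F L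
  let r := TensorProduct.equivFinsuppOfBasisRight (M := E) b
  refine ⟨fun {x y} hxy ↦ ?_⟩
  by_contra! hne
  obtain ⟨i, hi⟩ := Finsupp.ne_iff.1 ((map_ne_zero_iff r r.injective).2 hne.1)
  obtain ⟨j, hj⟩ := Finsupp.ne_iff.1 ((map_ne_zero_iff r r.injective).2 hne.2)
  simp only [Finsupp.coe_zero, Pi.zero_apply] at hi hj
  let s : Set E := Set.range (r x) ∪ Set.range (r y) ∪ {(r x i)⁻¹, (r y j)⁻¹}
  have hs : s.Finite := ((Finsupp.finite_range _).union (Finsupp.finite_range _)).union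
    (Set.toFinite _)
  obtain ⟨φ⟩ := nonempty_algHom_adjoin_of_finite (F := F) s hs
  set A := Algebra.adjoin F s
  have hsA {e : E} (he : e ∈ s) : e ∈ A := Algebra.subset_adjoin he
  have hrepr (a : F) (c) : b.repr (algebraMap F L a * b c) = Finsupp.single c a := by
    rw [← _root_.Algebra.smul_def, map_smul, b.repr_self, Finsupp.smul_single, smul_eq_mul, mul_one]
  have lift_mem (z : E ⊗[F] L) (hz : ∀ l, r z l ∈ A) : ∃ z' : A ⊗[F] L,
      Algebra.TensorProduct.map A.val (AlgHom.id F L) z' = z ∧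
      ∀ l, b.repr (Algebra.TensorProduct.lift ((Algebra.ofId F L).comp φ) (AlgHom.id F L)
        (fun _ _ ↦ .all _ _) z') l = φ ⟨r z l, hz l⟩ := by
    refine ⟨∑ l ∈ (r z).support, (⟨r z l, hz l⟩ : A) ⊗ₜ b l, ?_, fun l ↦ ?_⟩
    · have h := r.symm_apply_apply z
      rw [TensorProduct.equivFinsuppOfBasisRight_symm_apply] at h
      refine Eq.trans ?_ h
      simp [Finsupp.sum]
    · simp only [map_sum, Algebra.TensorProduct.lift_tmul, AlgHom.comp_apply, AlgHom.id_apply,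
        Algebra.ofId_apply]
      simp only [hrepr, Finsupp.coe_finsetSum, Finset.sum_apply, Finsupp.single_apply,
        Finset.sum_ite_eq', Finsupp.mem_support_iff, ne_eq, ite_not]
      split_ifs with h
      · have : (⟨r z l, hz l⟩ : A) = 0 := Subtype.ext h
        rw [this, map_zero]
      · rfl
  have unit_of (e : E) (h0 : e ≠ 0) (he : e ∈ A) (he' : e⁻¹ ∈ A) : φ ⟨e, he⟩ ≠ 0 := by
    intro h
    have h1 : (⟨e, he⟩ : A) * ⟨e⁻¹, he'⟩ = 1 := Subtype.ext (mul_inv_cancel₀ h0)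
    have h2 := congrArg φ h1
    rw [map_mul, h, zero_mul, map_one] at h2
    exact zero_ne_one h2
  obtain ⟨x', hx', hφx⟩ := lift_mem x fun l ↦ hsA (by simp [s])
  obtain ⟨y', hy', hφy⟩ := lift_mem y fun l ↦ hsA (by simp [s])
  have hinj : Function.Injective (Algebra.TensorProduct.map A.val (AlgHom.id F L)) :=
    Module.Flat.rTensor_preserves_injective_linearMap (M := L) A.val.toLinearMap
      Subtype.val_injective
  have h0 : x' * y' = 0 := hinj (by rw [map_mul, hx', hy', hxy, map_zero])
  have h1 := congrArg (Algebra.TensorProduct.lift ((Algebra.ofId F L).comp φ) (AlgHom.id F L)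
        (fun _ _ ↦ .all _ _)) h0
  rw [map_mul, map_zero, mul_eq_zero] at h1
  rcases h1 with h1 | h1
  · refine unit_of _ hi (hsA (by simp [s])) (hsA (by simp [s])) ((hφx i).symm.trans ?_)
    simp [h1]
  · refine unit_of _ hj (hsA (by simp [s])) (hsA (by simp [s])) ((hφy j).symm.trans ?_)
    simp [h1]

open scoped TensorProduct in
/-- If a transcendence basis of `E` over an algebraically closed field `F` remains algebraically
independent over `L` inside `K`, then `E ⊗ L` embeds in `K`. -/
theorem injective_productMap_of_algebraicIndependent {F E L K : Type*} {ι : Type*} [Field F]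
    [IsAlgClosed F] [Field E] [Field L] [Field K] [Algebra F E] [Algebra F L] [Algebra F K]
    (f : E →ₐ[F] K) (g : L →ₐ[F] K) [Algebra L K] (hg : ∀ l, algebraMap L K l = g l) {t : ι → E}
    (ht : IsTranscendenceBasis F t) (htL : AlgebraicIndependent L (f ∘ t)) :
    Function.Injective (Algebra.TensorProduct.productMap f g) := by
  have := TensorProduct.noZeroDivisors_of_isAlgClosed (F := F) (E := E) (L := L)
  let θ : MvPolynomial ι L →+* E ⊗[F] L :=
    eval₂Hom (Algebra.TensorProduct.includeRight (R := F) (A := E) (B := L)).toRingHom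
      (fun i ↦ t i ⊗ₜ 1)
  let : Algebra (MvPolynomial ι L) (E ⊗[F] L) := θ.toAlgebra
  have hθ (p : MvPolynomial ι L) :
      Algebra.TensorProduct.productMap f g (θ p) = aeval (f ∘ t) p := by
    induction p using MvPolynomial.induction_on with
    | C a => simp [θ, hg]
    | add p q hp hq => simp only [map_add, hp, hq]
    | mul_X p i hp => simp only [map_mul, hp]; simp [θ]
  let : Algebra (MvPolynomial ι F) E := (aeval (R := F) t).toRingHom.toAlgebra
  have halgE (e : E) : IsAlgebraic (MvPolynomial ι F) e := by
    have := ht.isAlgebraic.isAlgebraic e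
    refine this.of_ringHom_of_comp_eq (S := Algebra.adjoin F (Set.range t)) ht.1.aevalEquiv
      (RingHom.id E) ht.1.aevalEquiv.surjective Function.injective_id ?_
    ext <;> simp [RingHom.algebraMap_toAlgebra]
  have halg (x : E ⊗[F] L) : IsAlgebraic (MvPolynomial ι L) x := by
    induction x with
    | zero => exact isAlgebraic_zero
    | add x y hx hy => exact hx.add hy
    | tmul e l =>
      have : e ⊗ₜ[F] l = (e ⊗ₜ 1) * (1 ⊗ₜ l) := by simp
      rw [this]
      refine .mul ?_ ?_
      · refine (halgE e).ringHom_of_comp_eq (MvPolynomial.map (algebraMap F L))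
          (Algebra.TensorProduct.includeLeftRingHom (R := F) (A := E) (B := L))
          (MvPolynomial.map_injective _ (algebraMap F L).injective) ?_
        ext i
        · simp [RingHom.algebraMap_toAlgebra, θ, Algebra.TensorProduct.tmul_one_eq_one_tmul]
        · simp [RingHom.algebraMap_toAlgebra, θ]
      · convert! isAlgebraic_algebraMap (A := E ⊗[F] L) (C l : MvPolynomial ι L)
        simp [RingHom.algebraMap_toAlgebra, θ]
  rw [injective_iff_map_eq_zero]
  intro x hx
  by_contra hx0
  obtain ⟨p, hp, z, hz⟩ := (halg x).exists_nonzero_dvd (mem_nonZeroDivisors_of_ne_zero hx0)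
  refine hp (htL.eq_zero_of_aeval_eq_zero p ?_)
  rw [← hθ, show θ p = x * z from hz, map_mul, hx, zero_mul]

open scoped TensorProduct in
/-- Over an algebraically closed field `G`, algebraic freeness of `L` and `E` implies linear
disjointness. -/
theorem IntermediateField.linearDisjoint_of_algebraicIndependent {G E K ι : Type*} [Field G]
    [IsAlgClosed G] [Field E] [Field K] [Algebra G E] [Algebra G K] [Algebra E K]
    [IsScalarTower G E K] (L : IntermediateField G K) {t : ι → E} (ht : IsTranscendenceBasis G t)
    (htL : AlgebraicIndependent L (algebraMap E K ∘ t)) : L.LinearDisjoint E := by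
  rw [IntermediateField.linearDisjoint_iff, Subalgebra.linearDisjoint_iff_injective]
  let f := IsScalarTower.toAlgHom G E K
  have h := injective_productMap_of_algebraicIndependent f L.val (fun _ ↦ rfl) ht htL
  let e : L ⊗[G] f.range ≃ₐ[G] E ⊗[G] L :=
    (Algebra.TensorProduct.comm G L f.range).trans
      (Algebra.TensorProduct.congr (AlgEquiv.ofInjective f (algebraMap E K).injective).symm .refl)
  have he : (Algebra.TensorProduct.productMap f L.val).comp e.toAlgHom =
      L.toSubalgebra.mulMap f.range := by
    ext x
    · refine Eq.trans ?_ (Subalgebra.mulMap_tmul L.toSubalgebra f.range x 1).symm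
      simp [e]
    · obtain ⟨y, rfl⟩ := (AlgEquiv.ofInjective f (algebraMap E K).injective).surjective x
      refine Eq.trans ?_ (Subalgebra.mulMap_tmul L.toSubalgebra f.range 1 _).symm
      simp [e]
      rfl
  rw [← he]
  exact h.comp e.injective

theorem AlgebraicIndependent.of_injective_algebraMap {ι R S K : Type*} [CommRing R] [CommRing S]
    [CommRing K] [Algebra R K] [Algebra S K] {x : ι → K} (hx : AlgebraicIndependent S x)
    (f : R →+* S) (hf : Function.Injective (algebraMap R K))
    (hfK : ∀ r, algebraMap S K (f r) = algebraMap R K r) : AlgebraicIndependent R x :=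
  AlgebraicIndependent.of_ringHom_of_comp_eq f (RingHom.id K) (by simpa using hx)
    (fun a b h ↦ hf (by rw [← hfK, ← hfK, h])) (RingHom.ext hfK)

theorem AlgebraicIndependent.of_isAlgebraic_algebraMap {ι R S K : Type*} [CommRing R] [IsDomain R]
    [CommRing S] [Field K] [Algebra R K] [Algebra S K] {x : ι → K} (hx : AlgebraicIndependent R x)
    (hS : Function.Injective (algebraMap S K))
    (h : ∀ s, IsAlgebraic R (algebraMap S K s)) : AlgebraicIndependent S x :=
  hx.subalgebraAlgebraicClosure.of_injective_algebraMap
    ((algebraMap S K).codRestrict (Subalgebra.algebraicClosure R K) h) hS fun _ ↦ rfl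

/-- The elements of a field that are algebraic over a domain, as a subfield. -/
def Subfield.algebraicElements (R K : Type*) [CommRing R] [IsDomain R] [Field K] [Algebra R K] :
    Subfield K :=
  { Subalgebra.algebraicClosure R K with
    neg_mem' := fun h ↦ IsAlgebraic.neg h
    inv_mem' := fun _ h ↦ IsAlgebraic.inv h }

/-- If `y` is algebraically independent over a field `B` containing a family `x`,
then `x` stays algebraically independent over extensions algebraic over `A(y)`. -/
theorem AlgebraicIndependent.of_isAlgebraic_adjoin_range {ι κ K C : Type*} [Field K] [CommRing C]
    [Algebra C K] {A B : Subfield K} (hAB : A ≤ B) {x : ι → K} {y : κ → K} (hxB : ∀ i, x i ∈ B)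
    (hx : AlgebraicIndependent A x) (hy : AlgebraicIndependent B y)
    (hC : Function.Injective (algebraMap C K))
    (h : ∀ c, IsAlgebraic (Algebra.adjoin A (Set.range y)) (algebraMap C K c)) :
    AlgebraicIndependent C x := by
  have hle (z) (hz : z ∈ Algebra.adjoin A (Set.range x)) : z ∈ B := by
    induction hz using Algebra.adjoin_induction with
    | mem z hz => obtain ⟨i, rfl⟩ := hz; exact hxB i
    | algebraMap r => exact hAB r.2
    | add _ _ _ _ h₁ h₂ => exact add_mem h₁ h₂
    | mul _ _ _ _ h₁ h₂ => exact mul_mem h₁ h₂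
  have hy' : AlgebraicIndependent (Algebra.adjoin A (Set.range x)) y :=
    hy.of_injective_algebraMap
      ((Algebra.adjoin A (Set.range x)).val.toRingHom.codRestrict B fun z ↦ hle z z.2)
      Subtype.val_injective fun _ ↦ rfl
  have hsum : AlgebraicIndependent A (Sum.elim x y) := by
    refine (algebraicIndependent_equiv' (Equiv.sumComm ι κ) ?_).2
      (AlgebraicIndependent.sumElim_iff.2 ⟨hx, hy'⟩)
    ext i; cases i <;> rfl
  exact (AlgebraicIndependent.sumElim_iff.1 hsum).2.of_isAlgebraic_algebraMap hC h

section

variable {K : Type*} [Field K]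

theorem lambdaSubfield_le (E k : Subfield K) : lambdaSubfield E k ≤ E := by
  refine Subfield.closure_le.2 ?_
  rintro _ ⟨n, a, a₀, c, -, -, -, hc, -, rfl⟩
  exact hc 0

theorem lambdaSubfield_mono (E : Subfield K) {k L : Subfield K} (h : k ≤ L) :
    lambdaSubfield E k ≤ lambdaSubfield E L := by
  refine Subfield.closure_mono ?_
  rintro _ ⟨n, a, a₀, c, ha, h₀, H⟩
  exact ⟨n, a, a₀, c, fun i ↦ h (ha i), h h₀, H⟩

theorem linearIndependent_subfield_iff {E : Subfield K} {n : ℕ} {a : Fin n → K} :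
    LinearIndependent E a ↔
      ∀ b : Fin n → K, (∀ i, b i ∈ E) → ∑ i, b i * a i = 0 → ∀ i, b i = 0 := by
  rw [Fintype.linearIndependent_iff]
  refine ⟨fun h b hb hs i ↦ ?_, fun h g hg i ↦ ?_⟩
  · exact congrArg Subtype.val (h (fun i ↦ ⟨b i, hb i⟩) hs i)
  · exact Subtype.ext (h (fun i ↦ g i) (fun i ↦ (g i).2) hg i)

/-- All coefficients of a linear relation, and not only the first one, are λ-values. -/
theorem mem_lambdaSubfield_of_eq_sum {E k : Subfield K} {n : ℕ} {a : Fin n → K} {a₀ : K}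
    {c : Fin n → E} (ha : ∀ i, a i ∈ k) (ha₀ : a₀ ∈ k) (hli : LinearIndependent E a)
    (h : ∑ i, c i • a i = a₀) (i : Fin n) : (c i : K) ∈ lambdaSubfield E k := by
  obtain _ | n := n
  · exact i.elim0
  let σ := Equiv.swap 0 i
  refine Subfield.subset_closure ⟨n, a ∘ σ, a₀, fun j ↦ c (σ j), fun j ↦ ha _, ha₀,
    linearIndependent_subfield_iff.1 (hli.comp σ σ.injective), fun j ↦ (c (σ j)).2, ?_, ?_⟩
  · rw [← h]
    exact (Equiv.sum_comp σ fun j ↦ c j • a j).symm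
  · simp [σ]

theorem LinearIndependent.of_lambdaSubfield_fin {E k : Subfield K} {n : ℕ} {v : Fin n → K}
    (hv : ∀ i, v i ∈ k) (hli : LinearIndependent (lambdaSubfield E k) v) :
    LinearIndependent E v := by
  induction n with
  | zero => exact linearIndependent_empty_type
  | succ n ih =>
    rw [linearIndependent_finSucc] at hli ⊢
    have htail := ih (fun i ↦ hv i.succ) hli.1
    refine ⟨htail, fun hmem ↦ hli.2 ?_⟩
    obtain ⟨c, hc⟩ := (Submodule.mem_span_range_iff_exists_fun E).1 hmem
    exact (Submodule.mem_span_range_iff_exists_fun _).2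
      ⟨fun i ↦ ⟨c i, mem_lambdaSubfield_of_eq_sum (fun i ↦ hv i.succ) (hv 0) htail hc i⟩, hc⟩

/-- A family in `k` that is linearly independent over `λ(k)` is linearly independent over `E`. -/
theorem LinearIndependent.of_lambdaSubfield {ι : Type*} {E k : Subfield K} {v : ι → K}
    (hv : ∀ i, v i ∈ k) (hli : LinearIndependent (lambdaSubfield E k) v) :
    LinearIndependent E v := by
  rw [linearIndependent_iff_finset_linearIndependent] at hli ⊢
  intro s
  have := (hli s).comp _ s.equivFin.symm.injective
  have := LinearIndependent.of_lambdaSubfield_fin (fun i ↦ hv _) this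
  simpa [Function.comp_def] using this.comp _ s.equivFin.injective

theorem algebraicIndependent_iff_linearIndependent_monomials {ι R A : Type*} [CommRing R]
    [CommRing A] [Algebra R A] {x : ι → A} :
    AlgebraicIndependent R x ↔
      LinearIndependent R fun m : ι →₀ ℕ ↦ aeval x (monomial m (1 : R)) := by
  have h : (aeval x).toLinearMap =
      Finsupp.linearCombination R (fun m ↦ aeval x (monomial m (1 : R))) ∘ₗ
        (basisMonomials ι R).repr.toLinearMap :=
    (basisMonomials ι R).ext fun m ↦ by
      rw [LinearMap.comp_apply, LinearEquiv.coe_coe, Module.Basis.repr_self,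
        Finsupp.linearCombination_single, one_smul]
      rfl
  have h' : ⇑(aeval (R := R) x) =
      Finsupp.linearCombination R (fun m ↦ aeval x (monomial m (1 : R))) ∘
        (basisMonomials ι R).repr := congrArg DFunLike.coe h
  have h'' := EquivLike.injective_comp (basisMonomials ι R).repr
    (Finsupp.linearCombination R (fun m ↦ aeval x (monomial m (1 : R))))
  rwa [← h'] at h''

/-- `E` and `λ(k)[k]` are linearly disjoint over `λ(k)`, so tuples of `E` that are algebraically
independent over `λ(k)` remain so over `λ(k)·k`. -/
theorem AlgebraicIndependent.lambdaSubfield_sup {ι : Type*} {E k : Subfield K} {t : ι → K}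
    (htE : ∀ i, t i ∈ E) (ht : AlgebraicIndependent (lambdaSubfield E k) t) :
    AlgebraicIndependent ↥(lambdaSubfield E k ⊔ k) t := by
  set F := lambdaSubfield E k
  let EA : Subalgebra F K := { E with algebraMap_mem' := fun r ↦ lambdaSubfield_le E k r.2 }
  obtain ⟨b, hbk, hspan, hli⟩ := exists_linearIndependent F (k : Set K)
  have hcl : (Submonoid.closure (k : Set K) : Set K) = k :=
    congrArg SetLike.coe (Submonoid.closure_eq k.toSubmonoid)
  have hspan' : Submodule.span F (Set.range ((↑) : b → K)) =
      Subalgebra.toSubmodule (Algebra.adjoin F (k : Set K)) := by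
    rw [Subtype.range_coe, hspan, Algebra.adjoin_eq_span, hcl]
  let B := (Module.Basis.span hli).map (LinearEquiv.ofEq _ _ hspan')
  have hdisj : EA.LinearDisjoint (Algebra.adjoin F (k : Set K)) := by
    refine Subalgebra.LinearDisjoint.of_basis_right _ _ B ?_
    have h1 : LinearIndependent E ((↑) : b → K) :=
      LinearIndependent.of_lambdaSubfield (fun i ↦ hbk i.2) hli
    convert! h1 using 1
    ext i
    simp [B, Module.Basis.span_apply]
  let t' : ι → EA := fun i ↦ ⟨t i, htE i⟩
  have ht' : AlgebraicIndependent F t' := AlgebraicIndependent.of_comp EA.val ht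
  have := algebraicIndependent_iff_linearIndependent_monomials.1 ht'
  have h2 : AlgebraicIndependent (Algebra.adjoin F (k : Set K)) t := by
    rw [algebraicIndependent_iff_linearIndependent_monomials]
    convert! hdisj.linearIndependent_left_of_flat this using 1
    ext m
    refine Eq.trans ?_ (comp_aeval_apply t' EA.val (monomial m 1)).symm
    simp [aeval_monomial, t']
  refine h2.of_isAlgebraic_algebraMap Subtype.val_injective fun s ↦ ?_
  have hle : F ⊔ k ≤ Subfield.algebraicElements (Algebra.adjoin F (k : Set K)) K := by
    refine sup_le (fun x hx ↦ ?_) fun x hx ↦ ?_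
    · exact isAlgebraic_algebraMap (algebraMap F (Algebra.adjoin F (k : Set K)) ⟨x, hx⟩)
    · exact isAlgebraic_algebraMap (⟨x, Algebra.subset_adjoin hx⟩ : Algebra.adjoin F (k : Set K))
  exact hle s.2

theorem IsAlgebraic.of_subfield_le {F A : Subfield K} (hFA : F ≤ A) {x : K}
    (hx : IsAlgebraic F x) : IsAlgebraic A x :=
  hx.ringHom_of_comp_eq (Subfield.inclusion hFA) (RingHom.id K)
    (Set.inclusion_injective hFA) rfl

theorem IsAlgebraic.adjoin_of_subfield_le {F A : Subfield K} (hFA : F ≤ A) {S : Set K} {x : K}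
    (hx : IsAlgebraic (Algebra.adjoin F S) x) : IsAlgebraic (Algebra.adjoin A S) x := by
  have hle (z) (hz : z ∈ Algebra.adjoin F S) : z ∈ Algebra.adjoin A S := by
    induction hz using Algebra.adjoin_induction with
    | mem z hz => exact Algebra.subset_adjoin hz
    | algebraMap r => exact (Algebra.adjoin A S).algebraMap_mem ⟨r, hFA r.2⟩
    | add _ _ _ _ h₁ h₂ => exact add_mem h₁ h₂
    | mul _ _ _ _ h₁ h₂ => exact mul_mem h₁ h₂
  exact hx.ringHom_of_comp_eq ((Algebra.adjoin F S).val.toRingHom.codRestrict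
    (Algebra.adjoin A S) fun z ↦ hle z z.2) (RingHom.id K)
    (fun a b h ↦ Subtype.ext (congrArg (Algebra.adjoin A S).val h)) rfl

theorem algIndepOver_iff {F : Subfield K} {m : ℕ} {x : Fin m → K} :
    AlgIndepOver F x ↔ AlgebraicIndependent F x := by
  rw [AlgebraicIndependent, injective_iff_map_eq_zero]
  refine ⟨fun h p hp ↦ ?_, fun h p hp hx ↦ ?_⟩
  · refine map_injective (algebraMap F K) Subtype.val_injective ?_
    rw [map_zero]
    refine h _ (fun d ↦ ?_) ?_
    · rw [coeff_map]
      exact (coeff d p).2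
    · rwa [eval_map, ← aeval_def]
  · obtain ⟨q, rfl⟩ : p ∈ Set.range (map (algebraMap F K)) := by
      rw [mem_range_map_iff_coeffs_subset]
      intro a ha
      obtain ⟨d, -, rfl⟩ := mem_coeffs_iff.1 ha
      exact ⟨⟨_, hp d⟩, rfl⟩
    rw [h q (by rwa [eval_map, ← aeval_def] at hx), map_zero]

theorem algebraicOver_iff {F : Subfield K} {e : K} : AlgebraicOver F e ↔ IsAlgebraic F e := by
  refine ⟨fun ⟨p, hp, hpF, he⟩ ↦ ?_, fun ⟨p, hp, he⟩ ↦ ?_⟩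
  · obtain ⟨q, rfl⟩ := (Polynomial.mem_lifts p).1
      ((Polynomial.lifts_iff_coeff_lifts (f := algebraMap F K) p).2 fun n ↦ ⟨⟨_, hpF n⟩, rfl⟩)
    refine ⟨q, fun h ↦ hp (by rw [h, Polynomial.map_zero]), ?_⟩
    rwa [Polynomial.eval_map_algebraMap] at he
  · refine ⟨p.map (algebraMap F K), (Polynomial.map_ne_zero_iff Subtype.val_injective).2 hp,
      fun i ↦ ?_, by rwa [Polynomial.eval_map_algebraMap]⟩
    rw [Polynomial.coeff_map]
    exact (p.coeff i).2

/-- Every subset of `K` contains a subset algebraically independent over `F` over which it is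
algebraic. -/
theorem exists_algebraicIndepOn_isAlgebraic (F : Subfield K) (S : Set K) :
    ∃ s ⊆ S, AlgebraicIndependent F ((↑) : s → K) ∧
      ∀ x ∈ S, IsAlgebraic (Algebra.adjoin F (Set.range ((↑) : s → K))) x := by
  obtain ⟨s, -, ⟨hs, hsS⟩, hmax⟩ := exists_maximal_algebraicIndependent (R := F) ∅ S
    (Set.empty_subset S) (algebraicIndependent_empty_type_iff.2 Subtype.val_injective)
  refine ⟨s, hsS, hs, fun x hx ↦ ?_⟩
  rw [Subtype.range_coe]
  by_contra h
  have hins : AlgebraicIndepOn F id (insert x s) := hs.insert (by rwa [Set.image_id])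
  have hxs : x ∈ s := hmax ⟨hins, Set.insert_subset hx hsS⟩ (Set.subset_insert x s)
    (Set.mem_insert x s)
  exact h (isAlgebraic_algebraMap
    (⟨x, Algebra.subset_adjoin hxs⟩ : Algebra.adjoin F s))

theorem AlgFree.algebraicIndependent {A B C : Subfield K} (h : AlgFree A B C) {ι : Type*}
    {x : ι → K} (hxB : ∀ i, x i ∈ B) (hx : AlgebraicIndependent A x) :
    AlgebraicIndependent ↥(A ⊔ C) x := by
  refine algebraicIndependent_of_finite_type fun t ht ↦ ?_
  have := ht.fintype
  let e := Fintype.equivFin t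
  have h1 : AlgebraicIndependent A fun i ↦ x (e.symm i) :=
    hx.comp _ (Subtype.val_injective.comp e.symm.injective)
  have h2 := (algIndepOver_iff.1 (h _ _ (fun i ↦ hxB _) (algIndepOver_iff.2 h1))).comp e e.injective
  simpa [Function.comp_def] using h2

theorem algFree_of_isAlgebraic {E k L : Subfield K} (hkL : k ≤ L)
    (h : ∀ e ∈ lambdaSubfield E L, IsAlgebraic (lambdaSubfield E k) e) :
    AlgFree (lambdaSubfield E k ⊔ k) L E := by
  intro m x hxL hx
  rw [algIndepOver_iff] at hx ⊢
  set F := lambdaSubfield E k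
  set G := lambdaSubfield E L
  set A := F ⊔ k
  have hFG : F ≤ G := lambdaSubfield_mono E hkL
  have hx' : AlgebraicIndependent ↥(G ⊔ k) x := by
    refine hx.of_isAlgebraic_algebraMap Subtype.val_injective fun s ↦ ?_
    have hle : G ⊔ k ≤ Subfield.algebraicElements A K := by
      refine sup_le (fun e he ↦ ?_) fun e he ↦ ?_
      · exact (h e he).of_subfield_le le_sup_left
      · exact isAlgebraic_algebraMap (⟨e, le_sup_right (a := F) he⟩ : A)
    exact hle s.2
  obtain ⟨y, hyE, hy, hEy⟩ := exists_algebraicIndepOn_isAlgebraic G (E : Set K)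
  refine hx'.of_isAlgebraic_adjoin_range (B := G ⊔ L) (sup_le_sup_left hkL G)
    (fun i ↦ le_sup_right (a := G) (hxL i))
    (AlgebraicIndependent.lambdaSubfield_sup (fun i ↦ hyE i.2) hy) Subtype.val_injective
    fun c ↦ ?_
  set R := Algebra.adjoin ↥(G ⊔ k) (Set.range ((↑) : y → K))
  have hmem (x : K) (hx : x ∈ G ⊔ k) : x ∈ Subfield.algebraicElements R K :=
    isAlgebraic_algebraMap (algebraMap ↥(G ⊔ k) R ⟨x, hx⟩)
  have hle : A ⊔ E ≤ Subfield.algebraicElements R K := by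
    refine sup_le (fun x hx ↦ hmem x (sup_le_sup_right hFG k hx)) fun x hx ↦ ?_
    exact (hEy x hx).adjoin_of_subfield_le le_sup_left
  exact hle c.2

theorem isAlgebraic_of_algFree {E k L : Subfield K} [IsAlgClosed E]
    (h : AlgFree (lambdaSubfield E k ⊔ k) L E) :
    ∀ e ∈ lambdaSubfield E L, IsAlgebraic (lambdaSubfield E k) e := by
  set F := lambdaSubfield E k
  set A := F ⊔ k
  have hFE : F ≤ E := lambdaSubfield_le E k
  let := (Subfield.inclusion hFE).toAlgebra
  have : IsScalarTower F E K := .of_algebraMap_eq' rfl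
  let G := algebraicClosure F E
  have : IsAlgClosed G := (algebraicClosure.isAlgClosure F E).isAlgClosed
  have hGK (g : G) : IsAlgebraic F (algebraMap G K g) :=
    (mem_algebraicClosure_iff.1 g.2).algebraMap
  obtain ⟨ι, t, ht⟩ := exists_isTranscendenceBasis' G E
  have htF : AlgebraicIndependent F (algebraMap E K ∘ t) :=
    (ht.1.restrictScalars (algebraMap F G).injective).map'
      (f := IsScalarTower.toAlgHom F E K) (algebraMap E K).injective
  have htA : AlgebraicIndependent A (algebraMap E K ∘ t) := htF.lambdaSubfield_sup fun i ↦ (t i).2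
  obtain ⟨s, hsL, hs, hLs⟩ := exists_algebraicIndepOn_isAlgebraic A (L : Set K)
  let L' := IntermediateField.adjoin G (L : Set K)
  have hL'le : L'.toSubfield ≤
      Subfield.algebraicElements (Algebra.adjoin A (Set.range ((↑) : s → K))) K := by
    refine Subfield.closure_le.2 (Set.union_subset ?_ hLs)
    rintro _ ⟨g, rfl⟩
    have hg : IsAlgebraic A (algebraMap G K g) := (hGK g).of_subfield_le le_sup_left
    have hinj : Function.Injective (algebraMap A (Algebra.adjoin A (Set.range ((↑) : s → K)))) :=
      fun a b h ↦ Subtype.ext (congrArg (Algebra.adjoin A (Set.range ((↑) : s → K))).val h)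
    exact hg.extendScalars hinj
  have htL' : AlgebraicIndependent L' (algebraMap E K ∘ t) :=
    htA.of_isAlgebraic_adjoin_range (B := A ⊔ E) le_sup_left
      (fun i ↦ le_sup_right (a := A) (t i).2) (h.algebraicIndependent (fun i ↦ hsL i.2) hs)
      Subtype.val_injective fun c ↦ hL'le c.2
  have hdisj := L'.linearDisjoint_of_algebraicIndependent ht htL'
  have hli {n : ℕ} {a : Fin n → K} (ha : ∀ i, a i ∈ L) (hG : LinearIndependent G a) :
      LinearIndependent E a := by
    have haL' (i) : a i ∈ L' := IntermediateField.subset_adjoin G _ (ha i)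
    exact hdisj.linearIndependent_left (a := fun i ↦ (⟨a i, haL' i⟩ : L'))
      (LinearIndependent.of_comp L'.val.toLinearMap hG)
  have hle : lambdaSubfield E L ≤ Subfield.algebraicElements F K := by
    refine Subfield.closure_le.2 ?_
    rintro _ ⟨n, a, a₀, c, ha, ha₀, hlin, hc, rfl, rfl⟩
    rw [← linearIndependent_subfield_iff] at hlin
    have hsum : ∑ i, c i * a i ∈ Submodule.span E (Set.range a) :=
      (Submodule.mem_span_range_iff_exists_fun E).2 ⟨fun i ↦ ⟨c i, hc i⟩, rfl⟩
    have hmem : ∑ i, c i * a i ∈ Submodule.span G (Set.range a) := by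
      by_contra hnot
      have := hli (a := Fin.cons (∑ i, c i * a i) a) (Fin.cases ha₀ ha)
        (linearIndependent_finCons.2 ⟨hlin.restrict_scalars' G, hnot⟩)
      exact (linearIndependent_finCons.1 this).2 hsum
    obtain ⟨g, hg⟩ := (Submodule.mem_span_range_iff_exists_fun G).1 hmem
    have h0 := Fintype.linearIndependent_iffₛ.1 hlin (fun i ↦ algebraMap G E (g i))
      (fun i ↦ ⟨c i, hc i⟩) hg 0
    rw [← show algebraMap G K (g 0) = c 0 from congrArg Subtype.val h0]
    exact hGK (g 0)
  exact fun e he ↦ hle he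

end

/-- Let `E ⊊ K` be a proper pair of algebraically closed fields and
`k ⊆ L` subfields of `K`. Then `L` and `E` are algebraically free over the compositum
`λ(k)·k` if and only if every element of `λ(L)` is algebraic over `λ(k)`. -/
theorem algFree_iff_lambda_algebraic {K : Type*} [Field K] [IsAlgClosed K]
    (E : Subfield K) (hE : IsAlgClosed E) (hEproper : E ≠ ⊤)
    (k L : Subfield K) (hkL : k ≤ L) :
    AlgFree (lambdaSubfield E k ⊔ k) L E ↔
      ∀ e ∈ lambdaSubfield E L, AlgebraicOver (lambdaSubfield E k) e := by
  have := hE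
  simp only [algebraicOver_iff]
  exact ⟨isAlgebraic_of_algFree, algFree_of_isAlgebraic hkL⟩
end
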